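/- arXiv:2511.15326 — 3 statements merged into one kernel-verified Lean document; each statement's English description precedes it below -/
import Mathlib

section
/- Let D > 0, L ∈ ℕ, and let R^1 = Q^1∘K^1, ..., R^{2^L} = Q^{2^L}∘K^{2^L} be RNNs with matching dimensions (the input dimension of R^{l+1} equals the output dimension of R^l for l in {1,...,2^L - 1}). Assume there are constants D_1,...,D_{2^L} and D_h with max{2, max_l D_l} <= D_h such that for all l ∈ {1,...,2^L}: sup over x with ‖x‖_∞ <= D_{l-1} and t ∈ ℕ₀ of ‖(R^l D x)[t]‖_∞ is <= D_l, and the analogous sup of ‖(K^l D x)[t]‖_∞ is <= D_h, where D_0 = D. Define g_l^k(x) = (R^l D x)[2^k - 2] for l ∈ {1,...,2^L} and k >= 2. Then there exists an RNN R̂^L = Q̂^L∘K̂^L with hidden state size equal to sum_{l=1}^{2^L} m_l + 2 sum_{l=1}^{2^L - 1} d'_l + 5(2^L - 1) (where m_l and d'_l are the hidden and output dimensions of R^l) such that: (i) ‖(R̂^L D x)[t]‖_∞ <= D_{2^L} and ‖(K̂^L D x)[t]‖_∞ <= D_h for all ‖x‖_∞ <= D and t ∈ ℕ₀; (ii) (R̂^L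 D x)[2^k - 2] = (g_{2^L}^{k-L} ∘ ... ∘ g_1^{k-L})(x) for all k >= L + 2 and all x in [-D,D]^{d_1}; (iii) for every l ∈ {1,...,2^L} there exist a matrix A^l, a vector b^l, and integers k̃_1,...,k̃_l ∈ {0,...,⌈log l⌉} such that A^l (K̂^L D x)[2^k - 2] + b^l = (g_l^{k-k̃_l} ∘ ... ∘ g_1^{k-k̃_1})(x) for all k >= L + 2 and all x ∈ [-D,D]^{d_1}. -/
/-- ReLU applied componentwise. -/
noncomputable def relu {n : Type*} (v : n → ℝ) : n → ℝ := fun i => max 0 (v i)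

/-- An RNN with input index type `ι`, hidden state index type `κ`, output index type `ω`,
parametrized by weights `A_h, A_x, A_o, b_h, b_o`. -/
structure RNN (ι κ ω : Type) where
  Ah : Matrix κ κ ℝ
  Ax : Matrix κ ι ℝ
  Ao : Matrix ω κ ℝ
  bh : κ → ℝ
  bo : ω → ℝ

/-- Hidden state sequence `(K 𝒟 x)[t]` for the input sequence `(𝒟 x)[t] = x·1{t=0}`,
with the convention `h[-1] = 0`:  `h[0] = ρ(A_x x + b_h)`, `h[t+1] = ρ(A_h h[t] + b_h)`. -/
noncomputable def RNN.hid {ι κ ω : Type} [Fintype ι] [Fintype κ] (R : RNN ι κ ω)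
    (x : ι → ℝ) : ℕ → κ → ℝ
  | 0 => relu (R.Ax.mulVec x + R.bh)
  | t + 1 => relu (R.Ah.mulVec (RNN.hid R x t) + R.bh)

/-- Output sequence `(R 𝒟 x)[t] = A_o h[t] + b_o`. -/
noncomputable def RNN.out {ι κ ω : Type} [Fintype ι] [Fintype κ] (R : RNN ι κ ω)
    (x : ι → ℝ) (t : ℕ) : ω → ℝ :=
  R.Ao.mulVec (R.hid x t) + R.bo

/-- Iterated application of a chain of RNNs `Rs 0, Rs 1, …` (with matching dimensions
`d l → d (l+1)`), where network `Rs l` is evaluated at time `time l`: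
`chain n x = g_{n}(g_{n-1}(… g_1(x) …))` with `g_{l+1}(y) = (Rs l 𝒟 y)[time l]`. -/
noncomputable def RNN.chain (d m : ℕ → ℕ)
    (Rs : ∀ l : ℕ, RNN (Fin (d l)) (Fin (m l)) (Fin (d (l + 1))))
    (time : ℕ → ℕ) : (n : ℕ) → (Fin (d 0) → ℝ) → Fin (d n) → ℝ
  | 0, x => x
  | n + 1, x => (Rs n).out (RNN.chain d m Rs time n x) (time n)


noncomputable def catRNN {ι κ₁ ω κ₂ ω' : Type} (R1 : RNN ι κ₁ ω) (R2 : RNN ω κ₂ ω') (B M : ℝ) :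
    RNN ι (κ₁ ⊕ (κ₂ ⊕ ((ω ⊕ ω) ⊕ Fin 5))) ω' where
  Ah := Sum.elim
    (fun i => Sum.elim (R1.Ah i) 0)
    (Sum.elim
      (fun i => Sum.elim 0 (Sum.elim (R2.Ah i)
        (Sum.elim (Sum.elim (R2.Ax i) (fun a => -R2.Ax i a)) ![0, 0, -M, 0, 0])))
      (Sum.elim
        (Sum.elim
          (fun i => Sum.elim (R1.Ao i) (Sum.elim 0 (Sum.elim 0 ![0, 0, B, 0, 0])))
          (fun i => Sum.elim (fun a => -R1.Ao i a) (Sum.elim 0 (Sum.elim 0 ![0, 0, B, 0, 0]))))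
        (fun i => Sum.elim 0 (Sum.elim 0 (Sum.elim 0
          ((![![2, -7/4, -1/2, 1/8, -3/4],
             ![0, 1/4, -1/2, 1/8, -1/2],
             ![16, -16, -3, 0, -2],
             ![0, 0, 1, 0, 0],
             ![0, 0, 0, 0, 0]] : Fin 5 → Fin 5 → ℝ) i))))))
  Ax := fun i b => Sum.elim (fun a => R1.Ax a b) (fun _ => 0) i
  Ao := fun i => Sum.elim 0 (Sum.elim (R2.Ao i) (Sum.elim 0 ![0, 0, 0, -R2.bo i, 0]))
  bh := Sum.elim R1.bh (Sum.elim R2.bh (Sum.elim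
    (Sum.elim (fun i => R1.bo i - B) (fun i => -R1.bo i - B)) ![3/4, 1/2, 1, 0, 1]))
  bo := R2.bo

/-- Assembled state of the concatenated network. -/
def catState {κ₁ ω κ₂ : Type} (h1 : κ₁ → ℝ) (h2 : κ₂ → ℝ) (zp zn : ω → ℝ) (c : Fin 5 → ℝ) :
    κ₁ ⊕ (κ₂ ⊕ ((ω ⊕ ω) ⊕ Fin 5)) → ℝ :=
  Sum.elim h1 (Sum.elim h2 (Sum.elim (Sum.elim zp zn) c))

noncomputable def clockStep (w v p q s : ℝ) : Fin 5 → ℝ :=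
  ![max 0 (2 * w - 7/4 * v - p / 2 + q / 8 + 3/4 - 3/4 * s),
    max 0 (v / 4 + q / 8 - p / 2 + 1/2 - s / 2),
    max 0 (16 * (w - v) - 3 * p + 1 - 2 * s),
    max 0 p, 1]

section cat
variable {ι κ₁ ω κ₂ ω' : Type} [Fintype ι] [Fintype κ₁] [Fintype ω] [Fintype κ₂]
  (R1 : RNN ι κ₁ ω) (R2 : RNN ω κ₂ ω') (B M : ℝ)

theorem cat_step (h1 : κ₁ → ℝ) (h2 : κ₂ → ℝ) (zp zn : ω → ℝ) (w v p q s : ℝ) :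
    relu ((catRNN R1 R2 B M).Ah.mulVec (catState h1 h2 zp zn ![w, v, p, q, s])
      + (catRNN R1 R2 B M).bh) =
    catState (relu (R1.Ah.mulVec h1 + R1.bh))
      (relu (fun i => R2.Ah.mulVec h2 i + R2.Ax.mulVec (zp - zn) i + R2.bh i - M * p))
      (relu (fun i => (R1.Ao.mulVec h1 + R1.bo) i - B * (1 - p)))
      (relu (fun i => -(R1.Ao.mulVec h1 + R1.bo) i - B * (1 - p)))
      (clockStep w v p q s) := by
  funext i
  rcases i with i | i | (i | i) | i
  · simp [relu, catState, catRNN, Matrix.mulVec, dotProduct]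
  · simp only [relu, catState, catRNN, Matrix.mulVec, dotProduct, Pi.add_apply, Sum.elim_inl,
      Sum.elim_inr, Fintype.sum_sum_type, Fin.sum_univ_five, Pi.sub_apply]
    congr 1
    simp [mul_sub, Finset.sum_sub_distrib]
    ring
  · simp only [relu, catState, catRNN, Matrix.mulVec, dotProduct, Pi.add_apply, Sum.elim_inl,
      Sum.elim_inr, Fintype.sum_sum_type, Fin.sum_univ_five, Pi.sub_apply]
    congr 1
    simp
    ring
  · simp only [relu, catState, catRNN, Matrix.mulVec, dotProduct, Pi.add_apply, Sum.elim_inl,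
      Sum.elim_inr, Fintype.sum_sum_type, Fin.sum_univ_five, Pi.sub_apply]
    congr 1
    simp
    ring
  · simp only [relu, catState, catRNN, Matrix.mulVec, dotProduct, Pi.add_apply, Sum.elim_inl,
      Sum.elim_inr, Fintype.sum_sum_type, Fin.sum_univ_five, Pi.sub_apply]
    fin_cases i <;> simp [clockStep] <;> congr 1 <;> ring

theorem cat_init (x : ι → ℝ) (hB1 : ∀ i, |R1.bo i| ≤ B) :
    (catRNN R1 R2 B M).hid x 0 =
    catState (R1.hid x 0) (R2.hid 0 0) 0 0 ![3/4, 1/2, 1, 0, 1] := by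
  funext i
  rcases i with i | i | (i | i) | i
  · simp [RNN.hid, relu, catState, catRNN, Matrix.mulVec, dotProduct]
  · simp [RNN.hid, relu, catState, catRNN, Matrix.mulVec, dotProduct]
  · have := abs_le.1 (hB1 i)
    simp [RNN.hid, relu, catState, catRNN, Matrix.mulVec, dotProduct]
    linarith
  · have := abs_le.1 (hB1 i)
    simp [RNN.hid, relu, catState, catRNN, Matrix.mulVec, dotProduct]
    linarith
  · fin_cases i <;> simp [RNN.hid, relu, catState, catRNN, Matrix.mulVec, dotProduct] <;> norm_num

theorem cat_out (h1 : κ₁ → ℝ) (h2 : κ₂ → ℝ) (zp zn : ω → ℝ) (w v p q s : ℝ) :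
    (catRNN R1 R2 B M).Ao.mulVec (catState h1 h2 zp zn ![w, v, p, q, s])
      + (catRNN R1 R2 B M).bo = R2.Ao.mulVec h2 + (1 - q) • R2.bo := by
  funext i
  simp only [relu, catState, catRNN, Matrix.mulVec, dotProduct, Pi.add_apply, Sum.elim_inl,
      Sum.elim_inr, Fintype.sum_sum_type, Fin.sum_univ_five, Pi.sub_apply]
  simp
  ring

end cat

/-- numeric closed form of the clock -/
noncomputable def cU (j r : ℕ) : ℝ := (1/2) ^ (2 ^ j - 1 - r)
noncomputable def cV (r : ℕ) : ℝ := (1/2) ^ (1 + 2 * r)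
noncomputable def cP (j r : ℕ) : ℝ := if r + 1 = 2 ^ j then 1 else 0
noncomputable def cQ (j r : ℕ) : ℝ := if j ≠ 0 ∧ r = 0 then 1 else 0
noncomputable def clk (j r : ℕ) : Fin 5 → ℝ :=
  ![cU j r / 4 + (cV r - cQ j r / 2), cV r - cQ j r / 2, cP j r, cQ j r, 1]

noncomputable def clkNext (j r : ℕ) : Fin 5 → ℝ :=
  clockStep (cU j r / 4 + (cV r - cQ j r / 2)) (cV r - cQ j r / 2) (cP j r) (cQ j r) 1

theorem cV_bd (r : ℕ) : 0 < cV r ∧ cV r ≤ 1/2 := by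
  refine ⟨by unfold cV; positivity, ?_⟩
  unfold cV
  rw [pow_add, pow_one]
  have : ((1:ℝ)/2) ^ (2*r) ≤ 1 := pow_le_one₀ (by norm_num) (by norm_num)
  linarith

theorem cU_bd (j r : ℕ) : 0 < cU j r ∧ cU j r ≤ 1 :=
  ⟨by unfold cU; positivity, pow_le_one₀ (by norm_num) (by norm_num)⟩

theorem clk_step1 (j r : ℕ) (h : r + 1 < 2 ^ j) : clkNext j r = clk j (r + 1) := by
  have hj : j ≠ 0 := by rintro rfl; simp at h
  have hP : cP j r = 0 := by unfold cP; rw [if_neg (by omega)]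
  have hQ : cQ j (r+1) = 0 := by unfold cQ; simp
  have hV : cV (r+1) = cV r / 4 := by unfold cV; rw [mul_add, ← add_assoc, pow_add]; norm_num; ring
  have hU : cU j (r+1) = 2 * cU j r := by
    unfold cU
    have : 2 ^ j - 1 - r = (2 ^ j - 1 - (r+1)) + 1 := by omega
    rw [this, pow_succ]; ring
  have hv := cV_bd r
  have hu := cU_bd j r
  have h2 : max 0 (4 * cU j r - 1) = cP j (r+1) := by
    unfold cP
    split_ifs with h'
    · have : cU j r = 1/2 := by
        unfold cU
        have : 2 ^ j - 1 - r = 1 := by omega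
        rw [this]; norm_num
      rw [this]; norm_num
    · apply max_eq_left
      have : cU j r ≤ (1/2)^2 := by
        unfold cU
        exact pow_le_pow_of_le_one (by norm_num) (by norm_num) (by omega)
      linarith
  unfold clkNext clk clockStep
  rw [← h2, hU, hV, hQ, hP]
  congr 1
  · rw [max_eq_right] <;> linarith
  congr 1
  · rw [max_eq_right] <;> linarith
  congr 1
  · congr 1; ring
  congr 1
  simp

theorem clk_step2 (j r : ℕ) (h : r + 1 = 2 ^ j) : clkNext j r = clk (j+1) 0 := by
  have hP : cP j r = 1 := by unfold cP; rw [if_pos h]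
  have hP' : cP (j+1) 0 = 0 := by
    unfold cP; rw [if_neg]
    have := Nat.one_le_two_pow (n := j)
    rw [pow_succ]; omega
  have hQ : cQ (j+1) 0 = 1 := by unfold cQ; simp
  have hV : cV 0 = 1 / 2 := by unfold cV; norm_num
  have hU : cU j r = 1 := by
    unfold cU
    have : 2 ^ j - 1 - r = 0 := by omega
    rw [this, pow_zero]
  have hU' : cU (j+1) 0 = cV r := by
    unfold cU cV
    congr 1
    rw [pow_succ]; omega
  have hv := cV_bd r
  unfold clkNext clk clockStep
  rw [hU, hU', hV, hQ, hP, hP']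
  congr 1
  · rw [max_eq_right] <;> linarith
  congr 1
  · rw [max_eq_left] <;> linarith
  congr 1
  · rw [max_eq_left]; linarith
  congr 1
  simp

theorem clk_bd (j r : ℕ) (i : Fin 5) : |clk j r i| ≤ 2 := by
  have hv := cV_bd r
  have hu := cU_bd j r
  have hp : 0 ≤ cP j r ∧ cP j r ≤ 1 := by unfold cP; split_ifs <;> norm_num
  have hq : 0 ≤ cQ j r ∧ cQ j r ≤ 1 := by unfold cQ; split_ifs <;> norm_num
  fin_cases i <;> simp [clk] <;> rw [abs_le] <;> constructor <;> linarith

theorem mulVec_bd {α β : Type} [Fintype α] [Fintype β] (A : Matrix α β ℝ) (C : ℝ) :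
    ∃ K : ℝ, 0 ≤ K ∧ ∀ v : β → ℝ, ‖v‖ ≤ C → ∀ i, A.mulVec v i ≤ K := by
  classical
  let f := LinearMap.toContinuousLinearMap (Matrix.mulVecLin A)
  refine ⟨‖f‖ * |C|, by positivity, fun v hv i => ?_⟩
  have h1 : ‖f v‖ ≤ ‖f‖ * ‖v‖ := f.le_opNorm v
  have h2 : ‖f‖ * ‖v‖ ≤ ‖f‖ * |C| := by
    gcongr
    exact hv.trans (le_abs_self C)
  have h3 : |A.mulVec v i| ≤ ‖f v‖ := norm_le_pi_norm (f v) i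
  exact (le_abs_self _).trans (h3.trans (h1.trans h2))

theorem relu_sub_relu {n : Type} (y : n → ℝ) : relu y - relu (-y) = y := by
  funext i
  simp only [relu, Pi.sub_apply, Pi.neg_apply]
  rcases le_total 0 (y i) with h | h
  · rw [max_eq_right h, max_eq_left (by linarith)]; ring
  · rw [max_eq_left h, max_eq_right (by linarith)]; ring

theorem norm_relu_le {n : Type} [Fintype n] (y : n → ℝ) : ‖relu y‖ ≤ ‖y‖ := by
  rw [pi_norm_le_iff_of_nonneg (norm_nonneg _)]
  intro i
  refine le_trans ?_ (norm_le_pi_norm y i)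
  simp only [relu, Real.norm_eq_abs]
  rw [abs_of_nonneg (le_max_left _ _)]
  exact max_le (abs_nonneg _) (le_abs_self _)

section cat
variable {ι κ₁ ω κ₂ ω' : Type} [Fintype ι] [Fintype κ₁] [Fintype ω] [Fintype κ₂] [Fintype ω']

noncomputable def sH2 (R1 : RNN ι κ₁ ω) (R2 : RNN ω κ₂ ω') (x : ι → ℝ) (j r : ℕ) : κ₂ → ℝ :=
  if j = 0 then R2.hid 0 0 else if r = 0 then 0 else R2.hid (R1.out x (2 ^ j - 2)) (r - 1)

noncomputable def sZ (R1 : RNN ι κ₁ ω) (σ : ℝ) (x : ι → ℝ) (j r : ℕ) : ω → ℝ :=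
  if j ≠ 0 ∧ r = 0 then relu (σ • R1.out x (2 ^ j - 2)) else 0

theorem cat_inv (R1 : RNN ι κ₁ ω) (R2 : RNN ω κ₂ ω') (B M D0 D1 Dh : ℝ)
    (hD1 : 0 ≤ D1) (hDh : D1 ≤ Dh)
    (h1o : ∀ x, ‖x‖ ≤ D0 → ∀ t, ‖R1.out x t‖ ≤ D1)
    (h2h : ∀ x, ‖x‖ ≤ D1 → ∀ t, ‖R2.hid x t‖ ≤ Dh)
    (hB0 : ∀ i, |R1.bo i| ≤ B) (hB : D1 ≤ B)
    (hM : ∀ h : κ₂ → ℝ, ∀ z : ω → ℝ, ‖h‖ ≤ Dh → ‖z‖ ≤ D1 → ∀ i,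
      R2.Ah.mulVec h i + R2.Ax.mulVec z i + R2.bh i ≤ M)
    (x : ι → ℝ) (hx : ‖x‖ ≤ D0) (t : ℕ) :
    ∃ j r, r < 2 ^ j ∧ t + 1 = 2 ^ j + r ∧
      (catRNN R1 R2 B M).hid x t =
        catState (R1.hid x t) (sH2 R1 R2 x j r) (sZ R1 1 x j r) (sZ R1 (-1) x j r) (clk j r) := by
  induction t with
  | zero =>
    refine ⟨0, 0, by norm_num, by norm_num, ?_⟩
    rw [cat_init R1 R2 B M x hB0]
    congr 1
    · have h1 : cU 0 0 = 1 := by simp [cU]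
      have h2 : cV 0 = 1/2 := by norm_num [cV]
      have h3 : cP 0 0 = 1 := by simp [cP]
      have h4 : cQ 0 0 = 0 := by simp [cQ]
      rw [clk, h1, h2, h3, h4]
      norm_num
  | succ t ih =>
    obtain ⟨j, r, hr, ht, hs⟩ := ih
    have hy := h1o x hx t
    have hyi : ∀ i, |R1.out x t i| ≤ D1 := fun i => (norm_le_pi_norm (R1.out x t) i).trans hy
    have hZ : sZ R1 1 x j r - sZ R1 (-1) x j r =
        if j ≠ 0 ∧ r = 0 then R1.out x (2 ^ j - 2) else 0 := by
      unfold sZ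
      split_ifs
      · simpa using relu_sub_relu (R1.out x (2 ^ j - 2))
      · simp
    have step : (catRNN R1 R2 B M).hid x (t + 1) = catState (R1.hid x (t+1))
      (relu (fun i => R2.Ah.mulVec (sH2 R1 R2 x j r) i +
        R2.Ax.mulVec (sZ R1 1 x j r - sZ R1 (-1) x j r) i + R2.bh i - M * cP j r))
      (relu (fun i => R1.out x t i - B * (1 - cP j r)))
      (relu (fun i => - R1.out x t i - B * (1 - cP j r)))
      (clkNext j r) := by
      rw [RNN.hid, hs]
      exact cat_step R1 R2 B M _ _ _ _ _ _ _ _ _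
    by_cases hlast : r + 1 = 2 ^ j
    · refine ⟨j + 1, 0, by positivity, by rw [pow_succ]; omega, ?_⟩
      rw [step, clk_step2 j r hlast]
      have hP : cP j r = 1 := by rw [cP, if_pos hlast]
      have htt : 2 ^ (j+1) - 2 = t := by rw [pow_succ]; omega
      congr 1
      · rw [hP]
        funext i
        have h0 : sH2 R1 R2 x (j + 1) 0 = 0 := by simp [sH2]
        rw [h0]
        simp only [relu, Pi.zero_apply]
        apply max_eq_left
        have := hM (sH2 R1 R2 x j r) (sZ R1 1 x j r - sZ R1 (-1) x j r) ?_ ?_ i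
        · linarith
        · unfold sH2
          split_ifs
          · exact h2h 0 (by simpa using hD1) 0
          · simpa using hD1.trans hDh
          · exact h2h _ (h1o x hx _) _
        · rw [hZ]
          split_ifs
          · exact h1o x hx _
          · simpa using hD1
      · rw [hP]; simp [sZ, htt]
      · rw [hP]; simp [sZ, htt]; congr 1
    · have hlt : r + 1 < 2 ^ j := by omega
      have hj : j ≠ 0 := by rintro rfl; simp at hlt
      refine ⟨j, r + 1, hlt, by omega, ?_⟩
      rw [step, clk_step1 j r hlt]
      have hP : cP j r = 0 := by rw [cP, if_neg hlast]
      congr 1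
      · rw [hP, hZ]
        rcases Nat.eq_zero_or_pos r with rfl | hr0
        · simp [sH2, hj, RNN.hid]
          congr 1
        · obtain ⟨r, rfl⟩ : ∃ r', r = r' + 1 := ⟨r - 1, by omega⟩
          simp [sH2, hj, RNN.hid]
          congr 1
      · rw [hP]
        funext i
        have := abs_le.1 (hyi i)
        simp [relu, sZ]
        linarith
      · rw [hP]
        funext i
        have := abs_le.1 (hyi i)
        simp [relu, sZ]
        linarith

theorem concat (R1 : RNN ι κ₁ ω) (R2 : RNN ω κ₂ ω') (D0 D1 D2 Dh : ℝ)
    (hD0 : 0 ≤ D0) (hDh : D1 ≤ Dh) (hDh2 : 2 ≤ Dh)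
    (h1o : ∀ x, ‖x‖ ≤ D0 → ∀ t, ‖R1.out x t‖ ≤ D1)
    (h1h : ∀ x, ‖x‖ ≤ D0 → ∀ t, ‖R1.hid x t‖ ≤ Dh)
    (h2o : ∀ x, ‖x‖ ≤ D1 → ∀ t, ‖R2.out x t‖ ≤ D2)
    (h2h : ∀ x, ‖x‖ ≤ D1 → ∀ t, ‖R2.hid x t‖ ≤ Dh) :
    ∃ R : RNN ι (κ₁ ⊕ (κ₂ ⊕ ((ω ⊕ ω) ⊕ Fin 5))) ω', ∀ x, ‖x‖ ≤ D0 →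
      (∀ t, ‖R.out x t‖ ≤ D2 ∧ ‖R.hid x t‖ ≤ Dh) ∧
      (∀ t, (fun i => R.hid x t (Sum.inl i)) = R1.hid x t) ∧
      (∀ j, 1 ≤ j → (fun i => R.hid x (2 ^ (j+1) - 2) (Sum.inr (Sum.inl i))) =
        R2.hid (R1.out x (2 ^ j - 2)) (2 ^ j - 2)) ∧
      (∀ j, 1 ≤ j → R.out x (2 ^ (j+1) - 2) = R2.out (R1.out x (2 ^ j - 2)) (2 ^ j - 2)) := by
  have hD1 : 0 ≤ D1 := (norm_nonneg _).trans (h1o 0 (by simpa using hD0) 0)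
  have hD2 : 0 ≤ D2 := (norm_nonneg _).trans (h2o 0 (by simpa using hD1) 0)
  obtain ⟨K1, hK1, hM1⟩ := mulVec_bd R2.Ah Dh
  obtain ⟨K2, hK2, hM2⟩ := mulVec_bd R2.Ax D1
  have inv := cat_inv R1 R2 (D1 + ‖R1.bo‖) (K1 + K2 + ‖R2.bh‖) D0 D1 Dh hD1 hDh h1o h2h
    (fun i => by
      have : |R1.bo i| ≤ ‖R1.bo‖ := norm_le_pi_norm R1.bo i
      linarith)
    (by have := norm_nonneg R1.bo; linarith)
    (fun h z hh hz i => by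
      have h3 : |R2.bh i| ≤ ‖R2.bh‖ := norm_le_pi_norm R2.bh i
      have := hM1 h hh i
      have := hM2 z hz i
      have := le_abs_self (R2.bh i)
      linarith)
  generalize D1 + ‖R1.bo‖ = B at inv
  generalize K1 + K2 + ‖R2.bh‖ = M at inv
  refine ⟨catRNN R1 R2 B M, fun x hx => ?_⟩
  have hH : ∀ j r, ‖sH2 R1 R2 x j r‖ ≤ Dh := by
    intro j r
    unfold sH2
    split_ifs
    · exact h2h 0 (by simpa using hD1) 0
    · simpa using hD1.trans hDh
    · exact h2h _ (h1o x hx _) _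
  have hZ : ∀ σ : ℝ, |σ| = 1 → ∀ j r, ‖sZ R1 σ x j r‖ ≤ Dh := by
    intro σ hσ j r
    unfold sZ
    split_ifs
    · refine (norm_relu_le _).trans ?_
      rw [norm_smul, Real.norm_eq_abs, hσ, one_mul]
      exact (h1o x hx _).trans hDh
    · simpa using hD1.trans hDh
  have hO : ∀ t j r, (catRNN R1 R2 B M).hid x t =
        catState (R1.hid x t) (sH2 R1 R2 x j r) (sZ R1 1 x j r) (sZ R1 (-1) x j r) (clk j r) →
      (catRNN R1 R2 B M).out x t = R2.Ao.mulVec (sH2 R1 R2 x j r) + (1 - cQ j r) • R2.bo := by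
    intro t j r hs
    rw [RNN.out, hs]
    exact cat_out R1 R2 B M _ _ _ _ _ _ _ _ _
  have hT : ∀ j, 1 ≤ j → (catRNN R1 R2 B M).hid x (2 ^ (j+1) - 2) =
        catState (R1.hid x (2 ^ (j+1) - 2)) (R2.hid (R1.out x (2 ^ j - 2)) (2 ^ j - 2))
          (sZ R1 1 x j (2 ^ j - 1)) (sZ R1 (-1) x j (2 ^ j - 1)) (clk j (2 ^ j - 1)) ∧
      (catRNN R1 R2 B M).out x (2 ^ (j+1) - 2) =
        R2.out (R1.out x (2 ^ j - 2)) (2 ^ j - 2) := by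
    intro j hj
    obtain ⟨j', r, hr, ht, hs⟩ := inv x hx (2 ^ (j+1) - 2)
    have h2 : 2 ≤ 2 ^ j := by
      calc 2 = 2 ^ 1 := rfl
        _ ≤ 2 ^ j := Nat.pow_le_pow_right (by norm_num) hj
    have e1 : 2 ^ (j + 1) = 2 * 2 ^ j := by ring
    have e2 : 2 ^ (j' + 1) = 2 * 2 ^ j' := by ring
    have hjj : j' = j := by
      have a1 : 2 ^ j' < 2 ^ (j+1) := by omega
      have a2 : 2 ^ j < 2 ^ (j'+1) := by omega
      have := (Nat.pow_lt_pow_iff_right (by norm_num : 1 < 2)).1 a1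
      have := (Nat.pow_lt_pow_iff_right (by norm_num : 1 < 2)).1 a2
      omega
    subst hjj
    obtain rfl : r = 2 ^ j' - 1 := by omega
    have hHe : sH2 R1 R2 x j' (2 ^ j' - 1) = R2.hid (R1.out x (2 ^ j' - 2)) (2 ^ j' - 2) := by
      rw [sH2, if_neg (by omega), if_neg (by omega)]
      rfl
    refine ⟨hHe ▸ hs, ?_⟩
    rw [hO _ _ _ hs, hHe, cQ, if_neg (by omega)]
    simp [RNN.out]
  refine ⟨fun t => ?_, fun t => ?_, fun j hj => ?_, fun j hj => (hT j hj).2⟩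
  · obtain ⟨j, r, hr, ht, hs⟩ := inv x hx t
    constructor
    · rw [hO t j r hs, cQ]
      unfold sH2
      split_ifs with h1 h2 h3 h4 h5
      · exact absurd h1 h2.1
      · simpa [RNN.out] using h2o 0 (by simpa using hD1) 0
      · simpa using hD2
      · exact absurd ⟨h1, h3⟩ h4
      · exact absurd h5.2 h3
      · simpa [RNN.out] using h2o _ (h1o x hx _) _
    · rw [hs, pi_norm_le_iff_of_nonneg (by linarith)]
      rintro (i | i | (i | i) | i)
      · exact (norm_le_pi_norm (R1.hid x t) i).trans (h1h x hx t)
      · exact (norm_le_pi_norm (sH2 R1 R2 x j r) i).trans (hH j r)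
      · exact (norm_le_pi_norm (sZ R1 1 x j r) i).trans (hZ 1 (by norm_num) j r)
      · exact (norm_le_pi_norm (sZ R1 (-1) x j r) i).trans (hZ (-1) (by norm_num) j r)
      · exact (clk_bd j r i).trans hDh2
  · obtain ⟨j, r, hr, ht, hs⟩ := inv x hx t
    rw [hs]; rfl
  · rw [(hT j hj).1]; rfl

end cat

theorem chain_add (d m : ℕ → ℕ)
    (Rs : ∀ l : ℕ, RNN (Fin (d l)) (Fin (m l)) (Fin (d (l + 1))))
    (time : ℕ → ℕ) (N n : ℕ) (x : Fin (d 0) → ℝ) :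
    RNN.chain d m Rs time (N + n) x =
      RNN.chain (fun i => d (N + i)) (fun i => m (N + i)) (fun i => Rs (N + i))
        (fun i => time (N + i)) n (RNN.chain d m Rs time N x) := by
  induction n with
  | zero => rfl
  | succ n ih =>
    change (Rs (N + n)).out (RNN.chain d m Rs time (N + n) x) (time (N + n)) = _
    rw [ih]
    rfl

theorem chain_congr (d m : ℕ → ℕ)
    (Rs : ∀ l : ℕ, RNN (Fin (d l)) (Fin (m l)) (Fin (d (l + 1))))
    (s t : ℕ → ℕ) (n : ℕ) (h : ∀ i < n, s i = t i) (x : Fin (d 0) → ℝ) :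
    RNN.chain d m Rs s n x = RNN.chain d m Rs t n x := by
  induction n with
  | zero => rfl
  | succ n ih =>
    rw [RNN.chain, RNN.chain, ih (fun i hi => h i (by omega)), h n (by omega)]

theorem concat_all (L : ℕ) : ∀ (N : ℕ), N = 2 ^ L → ∀ (Dh : ℝ) (d m : ℕ → ℕ)
    (Rs : ∀ l : ℕ, RNN (Fin (d l)) (Fin (m l)) (Fin (d (l + 1))))
    (DD : ℕ → ℝ), 0 ≤ DD 0 → 2 ≤ Dh → (∀ l < N, DD (l + 1) ≤ Dh) →
    (∀ l < N, ∀ x : Fin (d l) → ℝ, ‖x‖ ≤ DD l → ∀ t : ℕ, ‖(Rs l).out x t‖ ≤ DD (l + 1)) →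
    (∀ l < N, ∀ x : Fin (d l) → ℝ, ‖x‖ ≤ DD l → ∀ t : ℕ, ‖(Rs l).hid x t‖ ≤ Dh) →
    ∃ (κ : Type) (_ : Fintype κ) (R : RNN (Fin (d 0)) κ (Fin (d N))),
      Fintype.card κ = (∑ l ∈ Finset.range N, m l) +
          2 * (∑ l ∈ Finset.range (N - 1), d (l + 1)) + 5 * (N - 1) ∧
      (∀ x : Fin (d 0) → ℝ, ‖x‖ ≤ DD 0 → ∀ t : ℕ,
        ‖R.out x t‖ ≤ DD N ∧ ‖R.hid x t‖ ≤ Dh) ∧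
      (∀ x : Fin (d 0) → ℝ, ‖x‖ ≤ DD 0 → ∀ k : ℕ, L + 2 ≤ k →
        R.out x (2 ^ k - 2) = RNN.chain d m Rs (fun _ => 2 ^ (k - L) - 2) N x) ∧
      (∀ n : ℕ, 1 ≤ n → n ≤ N →
        ∃ (A : Matrix (Fin (d n)) κ ℝ) (b : Fin (d n) → ℝ) (kt : ℕ → ℕ),
          (∀ i < n, kt i ≤ Nat.clog 2 n) ∧
          ∀ x : Fin (d 0) → ℝ, ‖x‖ ≤ DD 0 → ∀ k : ℕ, L + 2 ≤ k →
            A.mulVec (R.hid x (2 ^ k - 2)) + b =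
              RNN.chain d m Rs (fun i => 2 ^ (k - kt i) - 2) n x) := by
  induction L with
  | zero =>
    intro N hN Dh d m Rs DD h0 h2 hDD ho hh
    obtain rfl : N = 1 := by simpa using hN
    refine ⟨Fin (m 0), inferInstance, Rs 0, by simp, ?_, ?_, ?_⟩
    · exact fun x hx t => ⟨ho 0 (by norm_num) x hx t, hh 0 (by norm_num) x hx t⟩
    · intro x hx k hk
      rfl
    · intro n h1 hn
      obtain rfl : n = 1 := by omega
      refine ⟨(Rs 0).Ao, (Rs 0).bo, fun _ => 0, by simp, ?_⟩
      intro x hx k hk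
      rfl
  | succ L ih =>
    intro N hN Dh d m Rs DD h0 h2 hDD ho hh
    obtain ⟨P, hP⟩ : ∃ P, P = 2 ^ L := ⟨_, rfl⟩
    obtain rfl : N = P + P := by rw [hN, hP]; ring
    have hP1 : 1 ≤ P := by rw [hP]; exact Nat.one_le_two_pow
    obtain ⟨κ₁, i₁, R1, hc1, hb1, hf1, hp1⟩ := ih P hP Dh d m Rs DD h0 h2
      (fun l hl => hDD l (by omega)) (fun l hl => ho l (by omega)) (fun l hl => hh l (by omega))
    have hDP : 0 ≤ DD P :=
      (norm_nonneg _).trans (hb1 0 (by simpa using h0) 0).1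
    obtain ⟨κ₂, i₂, R2, hc2, hb2, hf2, hp2⟩ := ih P hP Dh (fun i => d (P + i)) (fun i => m (P + i))
      (fun i => Rs (P + i)) (fun i => DD (P + i)) hDP h2
      (fun l hl => hDD (P + l) (by omega)) (fun l hl => ho (P + l) (by omega))
      (fun l hl => hh (P + l) (by omega))
    have hDPh : DD P ≤ Dh := by
      have := hDD (P - 1) (by omega)
      rwa [Nat.sub_add_cancel hP1] at this
    obtain ⟨R, hR⟩ := concat R1 R2 (DD 0) (DD P) (DD (P + P)) Dh h0 hDPh h2
      (fun x hx t => (hb1 x hx t).1) (fun x hx t => (hb1 x hx t).2)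
      (fun x hx t => (hb2 x hx t).1) (fun x hx t => (hb2 x hx t).2)
    refine ⟨_, inferInstance, R, ?_, fun x hx => (hR x hx).1, ?_, ?_⟩
    · simp only [Fintype.card_sum, Fintype.card_fin, hc1, hc2]
      have e1 : P + P - 1 = (P - 1) + 1 + (P - 1) := by omega
      rw [Finset.sum_range_add, e1, Finset.sum_range_add, Finset.sum_range_succ]
      have e2 : P - 1 + 1 = P := by omega
      simp only [e2, ← add_assoc]
      omega
    · intro x hx k hk
      obtain ⟨k, rfl⟩ : ∃ k', k = k' + 1 := ⟨k - 1, by omega⟩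
      rw [(hR x hx).2.2.2 k (by omega), chain_add]
      have e : k + 1 - (L + 1) = k - L := by omega
      rw [e, ← hf1 x hx k (by omega)]
      exact hf2 _ (hb1 x hx _).1 k (by omega)
    · intro n h1n hn
      rcases le_or_gt n P with hnP | hnP
      · obtain ⟨A, b, kt, hkt, hA⟩ := hp1 n h1n hnP
        refine ⟨fun i => Sum.elim (A i) 0, b, kt, hkt, fun x hx k hk => ?_⟩
        rw [← hA x hx k (by omega), ← (hR x hx).2.1]
        congr 1
        funext i
        simp [Matrix.mulVec, dotProduct]
      · obtain ⟨n, rfl⟩ : ∃ n', n = P + n' := ⟨n - P, by omega⟩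
        obtain ⟨A, b, kt, hkt, hA⟩ := hp2 n (by omega) (by omega)
        have hcl : L + 1 ≤ Nat.clog 2 (P + n) := by
          have : L < Nat.clog 2 (P + n) := by
            rw [Nat.lt_clog_iff_pow_lt (by norm_num)]
            omega
          omega
        have hcn : Nat.clog 2 n ≤ L := by
          apply Nat.clog_le_of_le_pow
          omega
        refine ⟨fun i => Sum.elim 0 (Sum.elim (A i) 0), b,
          fun i => if i < P then L + 1 else kt (i - P) + 1, ?_, fun x hx k hk => ?_⟩
        · intro i hi
          dsimp only
          split_ifs
          · exact hcl
          · have := hkt (i - P) (by omega)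
            omega
        · obtain ⟨k, rfl⟩ : ∃ k', k = k' + 1 := ⟨k - 1, by omega⟩
          rw [chain_add]
          have e1 : RNN.chain d m Rs (fun i => 2 ^ (k + 1 - if i < P then L + 1 else kt (i - P) + 1) - 2) P x
              = R1.out x (2 ^ k - 2) := by
            rw [hf1 x hx k (by omega)]
            apply chain_congr
            intro i hi
            simp [hi]
          rw [e1]
          have e2 := hA (R1.out x (2 ^ k - 2)) (hb1 x hx _).1 k (by omega)
          have e3 : (fun i => 2 ^ (k + 1 - if P + i < P then L + 1 else kt (P + i - P) + 1) - 2)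
              = fun i => 2 ^ (k - kt i) - 2 := by
            funext i
            simp
          rw [e3, ← e2, ← (hR x hx).2.2.1 k (by omega)]
          congr 1
          funext i
          simp [Matrix.mulVec, dotProduct]

/-- Reindexing the hidden state. -/
def reRNN {ι κ κ' ω : Type} (e : κ' ≃ κ) (R : RNN ι κ ω) : RNN ι κ' ω where
  Ah := fun i j => R.Ah (e i) (e j)
  Ax := fun i j => R.Ax (e i) j
  Ao := fun i j => R.Ao i (e j)
  bh := fun i => R.bh (e i)
  bo := R.bo

theorem reRNN_mulVec {κ κ' ω : Type} [Fintype κ] [Fintype κ'] (e : κ' ≃ κ)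
    (A : Matrix ω κ ℝ) (h : κ → ℝ) :
    Matrix.mulVec (fun i j => A i (e j) : Matrix ω κ' ℝ) (fun i => h (e i)) = A.mulVec h := by
  funext i
  simp only [Matrix.mulVec, dotProduct]
  exact Equiv.sum_comp e (fun j => A i j * h j)

theorem reRNN_hid {ι κ κ' ω : Type} [Fintype ι] [Fintype κ] [Fintype κ'] (e : κ' ≃ κ)
    (R : RNN ι κ ω) (x : ι → ℝ) (t : ℕ) :
    (reRNN e R).hid x t = fun i => R.hid x t (e i) := by
  induction t with
  | zero => rfl
  | succ t ih =>
    rw [RNN.hid, ih]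
    funext i
    have := congrFun (reRNN_mulVec e R.Ah (R.hid x t)) (e i)
    simp only [RNN.hid, relu, Pi.add_apply]
    rw [← this]
    rfl

theorem reRNN_out {ι κ κ' ω : Type} [Fintype ι] [Fintype κ] [Fintype κ'] (e : κ' ≃ κ)
    (R : RNN ι κ ω) (x : ι → ℝ) (t : ℕ) :
    (reRNN e R).out x t = R.out x t := by
  rw [RNN.out, reRNN_hid, RNN.out, ← reRNN_mulVec e R.Ao]
  rfl

/-- Lemma (concatenation of `2^L` RNNs).  Networks are indexed from 0, i.e. `Rs l` is the
paper's `R^{l+1}` with input bound `DD l` (where `DD 0 = D`) and output bound `DD (l+1)`;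
`g_{l+1}^k(x) = (Rs l 𝒟 x)[2^k − 2]`; `⌈log₂⌉ = Nat.clog 2`. -/
theorem stmt9 (L : ℕ) (hL : 1 ≤ L) (D Dh : ℝ) (hD : 0 < D)
    (d m : ℕ → ℕ)
    (Rs : ∀ l : ℕ, RNN (Fin (d l)) (Fin (m l)) (Fin (d (l + 1))))
    (DD : ℕ → ℝ) (hDD0 : DD 0 = D)
    (hDh2 : 2 ≤ Dh) (hDhD : ∀ l < 2 ^ L, DD (l + 1) ≤ Dh)
    (hout : ∀ l < 2 ^ L, ∀ x : Fin (d l) → ℝ, ‖x‖ ≤ DD l →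
      ∀ t : ℕ, ‖(Rs l).out x t‖ ≤ DD (l + 1))
    (hhid : ∀ l < 2 ^ L, ∀ x : Fin (d l) → ℝ, ‖x‖ ≤ DD l →
      ∀ t : ℕ, ‖(Rs l).hid x t‖ ≤ Dh) :
    ∃ R : RNN (Fin (d 0))
        (Fin ((∑ l ∈ Finset.range (2 ^ L), m l) +
          2 * (∑ l ∈ Finset.range (2 ^ L - 1), d (l + 1)) + 5 * (2 ^ L - 1)))
        (Fin (d (2 ^ L))),
      -- (i) boundedness
      (∀ x : Fin (d 0) → ℝ, ‖x‖ ≤ D → ∀ t : ℕ,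
        ‖R.out x t‖ ≤ DD (2 ^ L) ∧ ‖R.hid x t‖ ≤ Dh) ∧
      -- (ii) full composition at times 2^k − 2
      (∀ x : Fin (d 0) → ℝ, ‖x‖ ≤ D → ∀ k : ℕ, L + 2 ≤ k →
        R.out x (2 ^ k - 2) =
          RNN.chain d m Rs (fun _ => 2 ^ (k - L) - 2) (2 ^ L) x) ∧
      -- (iii) affine readouts for the partial compositions
      (∀ n : ℕ, 1 ≤ n → n ≤ 2 ^ L →
        ∃ (A : Matrix (Fin (d n))
            (Fin ((∑ l ∈ Finset.range (2 ^ L), m l) +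
              2 * (∑ l ∈ Finset.range (2 ^ L - 1), d (l + 1)) + 5 * (2 ^ L - 1))) ℝ)
          (b : Fin (d n) → ℝ) (kt : ℕ → ℕ),
          (∀ i < n, kt i ≤ Nat.clog 2 n) ∧
          ∀ x : Fin (d 0) → ℝ, ‖x‖ ≤ D → ∀ k : ℕ, L + 2 ≤ k →
            A.mulVec (R.hid x (2 ^ k - 2)) + b =
              RNN.chain d m Rs (fun i => 2 ^ (k - kt i) - 2) n x) := by
  obtain ⟨κ, iκ, R, hc, hb, hf, hp⟩ := concat_all L (2 ^ L) rfl Dh d m Rs DD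
    (by rw [hDD0]; exact hD.le) hDh2 hDhD hout hhid
  rw [hDD0] at hb hf hp
  let e := (Fintype.equivFinOfCardEq hc).symm
  refine ⟨reRNN e R, ?_, ?_, ?_⟩
  · intro x hx t
    rw [reRNN_out, reRNN_hid]
    refine ⟨(hb x hx t).1, ?_⟩
    rw [pi_norm_le_iff_of_nonneg (by linarith)]
    exact fun i => (norm_le_pi_norm (R.hid x t) (e i)).trans (hb x hx t).2
  · intro x hx k hk
    rw [reRNN_out]
    exact hf x hx k hk
  · intro n h1 hn
    obtain ⟨A, b, kt, hkt, hA⟩ := hp n h1 hn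
    refine ⟨fun i j => A i (e j), b, kt, hkt, fun x hx k hk => ?_⟩
    rw [reRNN_hid, reRNN_mulVec]
    exact hA x hx k hk
end

section
/- Let L ∈ ℕ and D >= 1. There exists an RNN R = Q∘K with input dimension 1, output dimension 2^L, and hidden state size at most 40·2^L such that for all x ∈ [-D, D] and all integers k >= ⌈log L⌉ + 2: ((R D x)[2^k - 2])_1 = x, and for every l ∈ {1,...,L} and every j ∈ {1,...,2^{l-1}}: |((R D x)[2^k - 2])_{2^{l-1}+j} - x^{2^{l-1}+j}| <= ε_{l,k}, where ε_{l,k} = 8·2^l·D^{2^l}·4^{-(1/(2l))·2^k}. -/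
namespace PowNet

/-- Units: chain `l` (0-based), power index `i` (power `i+1`). -/
abbrev U (L : ℕ) : Type := Σ l : Fin L, Fin (2 ^ (l.val + 1))
abbrev K (L : ℕ) : Type := Fin 7 ⊕ (U L × Fin 18)
abbrev Fn (L : ℕ) : Type := (K L → ℝ) →ₗ[ℝ] ℝ

variable {L : ℕ}

noncomputable def gp (k : Fin 7) : Fn L := LinearMap.proj (Sum.inl k)
noncomputable def up (u : U L) (k : Fin 18) : Fn L := LinearMap.proj (Sum.inr (u, k))

noncomputable def zF : Fn L := gp 0 - gp 1
noncomputable def mF : Fn L := gp 4 - gp 5 + gp 6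
noncomputable def SF (u : U L) : Fn L := up u 0 + up u 1
noncomputable def cF (u : U L) : Fn L := up u 6 + up u 7
noncomputable def y0F (u : U L) : Fn L := up u 8 + up u 9 + up u 10 - up u 11
noncomputable def f0F (u : U L) : Fn L := up u 8 + up u 9 + up u 12 - up u 10 + up u 11
noncomputable def y1F (u : U L) : Fn L := up u 13 + up u 14 + up u 15 - up u 16
noncomputable def f1F (u : U L) : Fn L := up u 13 + up u 14 + up u 17 - up u 15 + up u 16
noncomputable def vF (u : U L) : Fn L := if u.2.val = 0 then zF else f0F u - f1F u

def ch1 (u : U L) : U L := ⟨u.1, ⟨u.2.val / 2, lt_of_le_of_lt (Nat.div_le_self _ _) u.2.2⟩⟩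
def ch2 (u : U L) : U L :=
  ⟨u.1, ⟨(u.2.val - 1) / 2, lt_of_le_of_lt (Nat.div_le_self _ _)
    (lt_of_le_of_lt (Nat.sub_le _ _) u.2.2)⟩⟩

noncomputable def lR (u : U L) : ℝ := ((u.1.val + 1 : ℕ) : ℝ)
noncomputable def gR (u : U L) : ℝ := ((Nat.log 2 u.2.val : ℕ) : ℝ)

noncomputable def pF (u : U L) : Fn L := vF (ch1 u)
noncomputable def qF (u : U L) : Fn L := vF (ch2 u)

noncomputable def glin : Fin 7 → Fn L :=
  ![gp 0, gp 1, gp 2, gp 3 - (3:ℝ) • mF, gp 3 - gp 2 - (2:ℝ) • mF, (2:ℝ) • mF - gp 3, mF]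
noncomputable def gbias : Fin 7 → ℝ := ![0, 0, 1, 2, 1, 0, 0]

noncomputable def E0 (u : U L) : Fn L := lR u • gp 3 - gR u • ((2:ℝ) • gp 2 - gp 3)
noncomputable def E1 (u : U L) : Fn L := lR u • (gp 2 - gp 3) - gR u • (gp 2 + gp 3)

noncomputable def ulin (u : U L) : Fin 18 → Fn L :=
  ![up u 2 - up u 3 - gp 6, up u 4 - up u 5 + gp 6,
    E0 u, E0 u, E1 u, E1 u,
    (1/4:ℝ) • cF u + SF u, - SF u,
    (1/2:ℝ) • (pF u + qF u) - SF u, -((1/2:ℝ) • (pF u + qF u)) - SF u,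
    (1/2:ℝ) • y0F u + SF u, y0F u - (1/2:ℝ) • cF u + SF u, f0F u + SF u,
    (1/2:ℝ) • (pF u - qF u) - SF u, -((1/2:ℝ) • (pF u - qF u)) - SF u,
    (1/2:ℝ) • y1F u + SF u, y1F u - (1/2:ℝ) • cF u + SF u, f1F u + SF u]
noncomputable def ubias (u : U L) : Fin 18 → ℝ :=
  ![0, -1, 2 * lR u - 2 * gR u + 1, 2 * lR u - 2 * gR u,
    3 * lR u - gR u + 1, 3 * lR u - gR u,
    -1, 1, 0, 0, -1, -1, -1, 0, 0, -1, -1, -1]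

noncomputable def lin : (K L → ℝ) →ₗ[ℝ] (K L → ℝ) :=
  LinearMap.pi (Sum.elim glin (fun w => ulin w.1 w.2))
noncomputable def bias : K L → ℝ := Sum.elim gbias (fun w => ubias w.1 w.2)
noncomputable def inp (D : ℝ) : K L → ℝ := Sum.elim ![1 / D, -(1 / D), 0, 0, 0, 0, 0] (fun _ => 0)

/-- State sequence starting from the zero state. -/
noncomputable def st (D x : ℝ) : ℕ → K L → ℝ
  | 0 => 0
  | t + 1 => fun k => max 0 (lin (st D x t) k + bias k + if t = 0 then inp D k * x else 0)

section scalar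

/-- Invariant of one squaring unit. -/
structure Sq (c y f U : ℝ) : Prop where
  y0 : 0 ≤ y
  yc : y ≤ c
  f1 : f ≤ 1
  eq : c * (f - U ^ 2) = y * (c - y)

lemma Sq.lower {c y f U : ℝ} (hc : 0 < c) (h : Sq c y f U) : U ^ 2 ≤ f := by
  have h1 : 0 ≤ c * (f - U ^ 2) := by
    rw [h.eq]; exact mul_nonneg h.y0 (by linarith [h.yc])
  have := nonneg_of_mul_nonneg_right h1 hc
  linarith

lemma Sq.upper {c y f U : ℝ} (hc : 0 < c) (h : Sq c y f U) : f ≤ U ^ 2 + c / 4 := by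
  have h1 : c * (f - U ^ 2) ≤ c * (c / 4) := by
    rw [h.eq]; nlinarith [sq_nonneg (y - c / 2)]
  have := le_of_mul_le_mul_left h1 hc
  linarith

lemma Sq.run {c y f U : ℝ} (hc : 0 < c) (h : Sq c y f U) :
    Sq (c / 4) (max 0 (1 / 2 * y) - max 0 (y - 1 / 2 * c))
      (max 0 f - max 0 (1 / 2 * y) + max 0 (y - 1 / 2 * c)) U := by
  have hl := h.lower hc
  have hf : 0 ≤ f := le_trans (sq_nonneg _) hl
  obtain ⟨h0, h1, h2, h3⟩ := h
  rw [max_eq_right hf, max_eq_right (by linarith : 0 ≤ 1 / 2 * y)]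
  rcases le_total (y - 1 / 2 * c) 0 with hy | hy
  · rw [max_eq_left hy]
    constructor <;> nlinarith
  · rw [max_eq_right hy]
    constructor <;> nlinarith

lemma Sq.load {p : ℝ} (hp : |p| ≤ 1) : Sq 1 (max 0 p + max 0 (-p)) (max 0 p + max 0 (-p)) p := by
  have : max 0 p + max 0 (-p) = |p| := by
    rcases le_total p 0 with h | h
    · rw [max_eq_left h, max_eq_right (by linarith), abs_of_nonpos h]; ring
    · rw [max_eq_right h, max_eq_left (by linarith), abs_of_nonneg h]; ring
  rw [this]
  refine ⟨abs_nonneg _, hp, hp, ?_⟩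
  rw [← sq_abs p]; ring

end scalar

section eqs
variable (D x : ℝ)

lemma st_inr (t : ℕ) (u : U L) (k : Fin 18) :
    st D x (t+1) (Sum.inr (u, k)) = max 0 (ulin u k (st D x t) + ubias u k) := by
  simp [st, lin, bias, inp]

lemma st_inl (t : ℕ) (k : Fin 7) (hk : 2 ≤ k) :
    st (L := L) D x (t+1) (Sum.inl k) = max 0 (glin k (st (L := L) D x t) + gbias k) := by
  have : inp (L := L) D (Sum.inl k) = 0 := by
    fin_cases k <;> simp_all [inp]
  simp only [st, this]
  simp [lin, bias]

lemma z_one : zF (st (L := L) D x 1) = x / D := by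
  have e : zF (st (L := L) D x 1) = max 0 (x / D) - max 0 (-(x/D)) := by
    simp [zF, gp, st, lin, bias, inp, glin, gbias]
    congr 2 <;> ring
  rw [e]
  rcases le_total (x/D) 0 with h | h
  · rw [max_eq_left h, max_eq_right (by linarith)]; ring
  · rw [max_eq_right h, max_eq_left (by linarith)]; ring

lemma z_all (t : ℕ) : zF (st (L := L) D x (t+1)) = x / D := by
  induction t with
  | zero => exact z_one D x
  | succ t ih =>
    rw [← ih]
    have h : ∀ k, 0 ≤ st (L := L) D x (t+1) k := fun k => le_max_left _ _
    have a : ∀ k : Fin 7, k < 2 → st (L := L) D x (t+1+1) (Sum.inl k) = st (L := L) D x (t+1) (Sum.inl k) := by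
      intro k hk
      rw [st.eq_def]
      simp only [Nat.add_eq_zero_iff, one_ne_zero, and_false, if_false, add_zero]
      have : lin (st (L := L) D x (t+1)) (Sum.inl k) + bias (L := L) (Sum.inl k) = st (L := L) D x (t+1) (Sum.inl k) := by
        have : k = 0 ∨ k = 1 := by omega
        rcases this with rfl | rfl <;> simp [lin, bias, glin, gbias, gp]
      rw [this]
      exact max_eq_right (h _)
    simp only [zF, gp, LinearMap.sub_apply, LinearMap.proj_apply]
    rw [a 0 (by decide), a 1 (by decide)]

lemma st_zero : st (L := L) D x 0 = 0 := rfl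

/-- Clock predicate. -/
def Clock (s : K L → ℝ) (t Q n : ℕ) : Prop :=
  t + 1 = Q + n ∧ n < Q ∧ gp 2 s = (t : ℝ) ∧
    ((mF s = 0 ∧ gp 3 s = 2 * (n : ℝ)) ∨ (mF s = 1 ∧ gp 3 s = (Q : ℝ) - n))

lemma g2_eq (t : ℕ) : gp 2 (st (L := L) D x (t+1)) = max 0 (gp 2 (st (L := L) D x t) + 1) := by
  have := st_inl (L := L) D x t 2 (by decide)
  simpa [gp, glin, gbias] using this
lemma g3_eq (t : ℕ) : gp 3 (st (L := L) D x (t+1)) =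
    max 0 (gp 3 (st (L := L) D x t) - 3 * mF (st (L := L) D x t) + 2) := by
  have := st_inl (L := L) D x t 3 (by decide)
  simpa [gp, glin, gbias] using this
lemma g6_eq (t : ℕ) : gp 6 (st (L := L) D x (t+1)) = max 0 (mF (st (L := L) D x t)) := by
  have := st_inl (L := L) D x t 6 (by decide)
  simpa [gp, glin, gbias] using this
lemma m_eq (t : ℕ) : mF (st (L := L) D x (t+1)) =
    max 0 (gp 3 (st (L := L) D x t) - gp 2 (st (L := L) D x t) - 2 * mF (st (L := L) D x t) + 1)
    - max 0 (2 * mF (st (L := L) D x t) - gp 3 (st (L := L) D x t))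
    + max 0 (mF (st (L := L) D x t)) := by
  have h4 := st_inl (L := L) D x t 4 (by decide)
  have h5 := st_inl (L := L) D x t 5 (by decide)
  have h6 := st_inl (L := L) D x t 6 (by decide)
  have : mF (st (L := L) D x (t+1)) = st (L := L) D x (t+1) (Sum.inl 4)
    - st (L := L) D x (t+1) (Sum.inl 5) + st (L := L) D x (t+1) (Sum.inl 6) := rfl
  rw [this, h4, h5, h6]
  simp [gp, glin, gbias]

lemma clock_step {t Q n : ℕ} (h : Clock (st (L := L) D x t) t Q n) :
    (n + 1 < Q → Clock (st (L := L) D x (t+1)) (t+1) Q (n+1)) ∧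
    (n + 1 = Q → Clock (st (L := L) D x (t+1)) (t+1) (2*Q) 0) := by
  obtain ⟨h1, h2, h3, h4⟩ := h
  have e2 := g2_eq (L := L) D x t
  have e3 := g3_eq (L := L) D x t
  have em := m_eq (L := L) D x t
  have h1' : (t:ℝ) + 1 = Q + n := by exact_mod_cast h1
  have hn0 : (0:ℝ) ≤ n := Nat.cast_nonneg n
  have ht0 : (0:ℝ) ≤ t := Nat.cast_nonneg t
  have hnq : (n:ℝ) + 1 ≤ Q := by exact_mod_cast h2
  rw [h3] at e2 em
  rw [max_eq_right (by linarith)] at e2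
  constructor
  · intro hlt
    have hlt' : (n:ℝ) + 2 ≤ Q := by exact_mod_cast hlt
    refine ⟨by omega, hlt, by rw [e2]; push_cast; ring, ?_⟩
    rcases h4 with ⟨hm, hb⟩ | ⟨hm, hb⟩
    · left
      rw [hm, hb] at em e3
      rw [max_eq_left (by linarith), max_eq_left (by linarith), max_eq_left (by linarith)] at em
      rw [max_eq_right (by linarith)] at e3
      refine ⟨by rw [em]; ring, by rw [e3]; push_cast; ring⟩
    · right
      rw [hm, hb] at em e3
      rw [max_eq_left (by linarith), max_eq_left (by linarith), max_eq_right (by linarith)] at em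
      rw [max_eq_right (by linarith)] at e3
      refine ⟨by rw [em]; ring, by rw [e3]; push_cast; ring⟩
  · intro heq
    have heq' : (n:ℝ) + 1 = Q := by exact_mod_cast heq
    refine ⟨by omega, by omega, by rw [e2]; push_cast; ring, ?_⟩
    rcases h4 with ⟨hm, hb⟩ | ⟨hm, hb⟩
    · right
      rw [hm, hb] at em e3
      rw [max_eq_right (by linarith), max_eq_left (by linarith), max_eq_left (by linarith)] at em
      rw [max_eq_right (by linarith)] at e3
      refine ⟨by rw [em]; linarith, by rw [e3]; push_cast; linarith⟩
    · left
      rw [hm, hb] at em e3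
      rw [max_eq_left (by linarith), max_eq_right (by linarith), max_eq_right (by linarith)] at em
      rw [max_eq_right (by linarith)] at e3
      refine ⟨by rw [em]; linarith, by rw [e3]; push_cast; linarith⟩

lemma clock_all (k : ℕ) : ∀ n, n < 2 ^ k →
    Clock (st (L := L) D x (2 ^ k + n - 1)) (2 ^ k + n - 1) (2 ^ k) n := by
  induction k with
  | zero =>
    intro n hn
    have : n = 0 := by simpa using hn
    subst this
    simp [Clock, st_zero]
  | succ k ih =>
    intro n
    induction n with
    | zero =>
      intro _
      have hp : 0 < 2 ^ k := Nat.two_pow_pos k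
      have := (clock_step D x (ih (2 ^ k - 1) (by omega))).2 (by omega)
      have e : 2 ^ k + (2 ^ k - 1) - 1 + 1 = 2 ^ (k+1) + 0 - 1 := by rw [pow_succ]; omega
      rw [e] at this
      rw [pow_succ, mul_comm (2 ^ k) 2] at this ⊢
      exact this
    | succ n ihn =>
      intro hn
      have hp : 0 < 2 ^ (k+1) := Nat.two_pow_pos _
      have := (clock_step D x (ihn (by omega))).1 hn
      have e : 2 ^ (k+1) + n - 1 + 1 = 2 ^ (k+1) + (n + 1) - 1 := by omega
      rw [e] at this
      exact this

end eqs

section units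
variable (D x : ℝ)

lemma up_eq (t : ℕ) (u : U L) (k : Fin 18) :
    up u k (st (L := L) D x (t+1)) = max 0 (ulin u k (st (L := L) D x t) + ubias u k) :=
  st_inr D x t u k

lemma S_eq (t : ℕ) (u : U L) : SF u (st (L := L) D x (t+1)) =
    max 0 (up u 2 (st (L := L) D x t) - up u 3 (st (L := L) D x t) - gp 6 (st (L := L) D x t))
    + max 0 (up u 4 (st (L := L) D x t) - up u 5 (st (L := L) D x t)
      + gp 6 (st (L := L) D x t) - 1) := by
  have h0 := up_eq D x t u 0
  have h1 := up_eq D x t u 1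
  rw [SF, LinearMap.add_apply, h0, h1]
  simp [ulin, ubias, sub_eq_add_neg]

lemma ramp_mem (e : ℝ) : 0 ≤ max 0 (e + 1) - max 0 e ∧ max 0 (e + 1) - max 0 e ≤ 1 := by
  rcases le_total e 0 with h | h
  · rw [max_eq_left h]
    rcases le_total (e + 1) 0 with h' | h'
    · rw [max_eq_left h']; norm_num
    · rw [max_eq_right h']; constructor <;> linarith
  · rw [max_eq_right h, max_eq_right (by linarith)]; constructor <;> linarith

lemma ramp_int (e : ℤ) : max 0 ((2 * e : ℝ) + 1) - max 0 (2 * e : ℝ) = if 0 ≤ e then 1 else 0 := by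
  split_ifs with h
  · have : (0:ℝ) ≤ e := by exact_mod_cast h
    rw [max_eq_right (by linarith), max_eq_right (by linarith)]; ring
  · have h' : e + 1 ≤ 0 := by omega
    have : (e:ℝ) + 1 ≤ 0 := by exact_mod_cast h'
    rw [max_eq_left (by linarith), max_eq_left (by linarith)]; ring

lemma D0_eq (t : ℕ) (u : U L) : ∃ e : ℝ,
    e = lR u * gp 3 (st (L := L) D x t)
      - gR u * (2 * gp 2 (st (L := L) D x t) - gp 3 (st (L := L) D x t)) + (2 * lR u - 2 * gR u) ∧
    up u 2 (st (L := L) D x (t+1)) - up u 3 (st (L := L) D x (t+1)) = max 0 (e + 1) - max 0 e := by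
  refine ⟨_, rfl, ?_⟩
  have h0 := up_eq D x t u 2
  have h1 := up_eq D x t u 3
  rw [h0, h1]
  simp [ulin, ubias, E0, add_assoc]

lemma D1_eq (t : ℕ) (u : U L) : ∃ e : ℝ,
    e = lR u * (gp 2 (st (L := L) D x t) - gp 3 (st (L := L) D x t))
      - gR u * (gp 2 (st (L := L) D x t) + gp 3 (st (L := L) D x t)) + (3 * lR u - gR u) ∧
    up u 4 (st (L := L) D x (t+1)) - up u 5 (st (L := L) D x (t+1)) = max 0 (e + 1) - max 0 e := by
  refine ⟨_, rfl, ?_⟩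
  have h0 := up_eq D x t u 4
  have h1 := up_eq D x t u 5
  rw [h0, h1]
  simp [ulin, ubias, E1, add_assoc, mul_add]

lemma S_val {t Q n : ℕ} (h : Clock (st (L := L) D x t) t Q n) (u : U L) :
    SF u (st (L := L) D x (t+2)) =
      if Nat.log 2 u.2.val * Q ≤ (u.1.val + 1) * (n + 1) then 1 else 0 := by
  obtain ⟨h1, h2, h3, h4⟩ := h
  have h1' : (t:ℝ) + 1 = Q + n := by exact_mod_cast h1
  obtain ⟨e0, he0, hd0⟩ := D0_eq D x t u
  obtain ⟨e1, he1, hd1⟩ := D1_eq D x t u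
  have hS := S_eq D x (t+1) u
  have h6 := g6_eq (L := L) D x t
  rw [hd0, hd1, h6] at hS
  have r0 := ramp_mem e0
  have r1 := ramp_mem e1
  have ht : (t:ℝ) = Q + n - 1 := by linarith
  let e : ℤ := ((u.1.val + 1 : ℕ) : ℤ) * ((n + 1 : ℕ) : ℤ) - ((Nat.log 2 u.2.val : ℕ) : ℤ) * (Q : ℤ)
  have hee : (e : ℝ) = lR u * (n + 1) - gR u * Q := by
    simp only [e, lR, gR]; push_cast; ring
  have hiff : (0 ≤ e) ↔ Nat.log 2 u.2.val * Q ≤ (u.1.val + 1) * (n + 1) := by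
    simp only [e]
    rw [sub_nonneg]; exact_mod_cast Iff.rfl
  have hr := ramp_int e
  simp only [hiff] at hr
  rw [← hr]
  rcases h4 with ⟨hm, hb⟩ | ⟨hm, hb⟩
  · have : e0 = 2 * e := by rw [he0, h3, hb, hee, ht]; ring
    rw [hm, this] at hS
    rw [this] at r0
    rw [hS, max_self, sub_zero, max_eq_right r0.1, add_zero, max_eq_left (by linarith : _ - 1 ≤ (0:ℝ)),
      add_zero]
  · have : e1 = 2 * e := by rw [he1, h3, hb, hee, ht]; ring
    rw [hm, this] at hS
    rw [this] at r1
    rw [max_eq_right (zero_le_one : (0:ℝ) ≤ 1)] at hS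
    rw [hS, max_eq_left (by linarith : _ - 1 ≤ (0:ℝ)), zero_add, add_sub_cancel_right,
      max_eq_right r1.1]

lemma S_zero (u : U L) : SF u (st (L := L) D x 0) = 0 := by simp [st_zero]
lemma S_one (u : U L) : SF u (st (L := L) D x 1) = 0 := by
  rw [S_eq D x 0 u]; simp [st_zero]

lemma clock_ex (t : ℕ) : ∃ Q n, Clock (st (L := L) D x t) t Q n := by
  induction t with
  | zero => exact ⟨1, 0, by simpa using clock_all (L := L) D x 0 0 (by simp)⟩
  | succ t ih =>
    obtain ⟨Q, n, h⟩ := ih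
    have := clock_step D x h
    rcases Nat.lt_or_ge (n+1) Q with h' | h'
    · exact ⟨_, _, this.1 h'⟩
    · exact ⟨_, _, this.2 (by have := h.2.1; omega)⟩

lemma S_bin (t : ℕ) (u : U L) : SF u (st (L := L) D x t) = 0 ∨ SF u (st (L := L) D x t) = 1 := by
  match t with
  | 0 => left; exact S_zero D x u
  | 1 => left; exact S_one D x u
  | t + 2 =>
    obtain ⟨Q, n, h⟩ := clock_ex (L := L) D x t
    rw [S_val D x h u]
    split_ifs <;> simp

/-- Invariant of a product unit. -/
def Inv (s : K L → ℝ) (u : U L) (a b : ℝ) (r : ℕ) : Prop :=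
  cF u s = (1/4:ℝ) ^ r ∧ Sq (cF u s) (y0F u s) (f0F u s) a ∧ Sq (cF u s) (y1F u s) (f1F u s) b

/-- Bounds needed for gating. -/
def Bd (s : K L → ℝ) (u : U L) : Prop :=
  0 ≤ cF u s ∧ cF u s ≤ 1 ∧ 0 ≤ y0F u s ∧ y0F u s ≤ 1 ∧ 0 ≤ f0F u s ∧ f0F u s ≤ 1 ∧
  0 ≤ y1F u s ∧ y1F u s ≤ 1 ∧ 0 ≤ f1F u s ∧ f1F u s ≤ 1

lemma Inv.bd {s : K L → ℝ} {u : U L} {a b : ℝ} {r : ℕ} (h : Inv s u a b r) : Bd s u := by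
  obtain ⟨h1, h2, h3⟩ := h
  have hc : 0 < cF u s := by rw [h1]; positivity
  have hc1 : cF u s ≤ 1 := by rw [h1]; exact pow_le_one₀ (by norm_num) (by norm_num)
  have l2 := h2.lower hc
  have l3 := h3.lower hc
  exact ⟨hc.le, hc1, h2.y0, h2.yc.trans hc1, (sq_nonneg _).trans l2, h2.f1,
    h3.y0, h3.yc.trans hc1, (sq_nonneg _).trans l3, h3.f1⟩

lemma c_eq (t : ℕ) (u : U L) : cF u (st (L := L) D x (t+1)) =
    max 0 (1/4 * cF u (st (L := L) D x t) + SF u (st (L := L) D x t) - 1)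
    + max 0 (1 - SF u (st (L := L) D x t)) := by
  rw [show cF u (st (L := L) D x (t+1)) = _ + _ from rfl, up_eq, up_eq]
  simp [ulin, ubias, sub_eq_add_neg, add_comm, add_left_comm]

lemma n8 (t : ℕ) (u : U L) : up u 8 (st (L := L) D x (t+1)) =
    max 0 ((pF u (st (L := L) D x t) + qF u (st (L := L) D x t)) / 2 - SF u (st (L := L) D x t)) := by
  rw [up_eq]; simp [ulin, ubias]; ring_nf
lemma n9 (t : ℕ) (u : U L) : up u 9 (st (L := L) D x (t+1)) =
    max 0 (-((pF u (st (L := L) D x t) + qF u (st (L := L) D x t)) / 2) - SF u (st (L := L) D x t)) := by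
  rw [up_eq]; simp [ulin, ubias]; ring_nf
lemma n10 (t : ℕ) (u : U L) : up u 10 (st (L := L) D x (t+1)) =
    max 0 (1 / 2 * y0F u (st (L := L) D x t) + SF u (st (L := L) D x t) - 1) := by
  rw [up_eq]; simp [ulin, ubias]; ring_nf
lemma n11 (t : ℕ) (u : U L) : up u 11 (st (L := L) D x (t+1)) =
    max 0 (y0F u (st (L := L) D x t) - 1 / 2 * cF u (st (L := L) D x t)
      + SF u (st (L := L) D x t) - 1) := by
  rw [up_eq]; simp [ulin, ubias]; ring_nf
lemma n12 (t : ℕ) (u : U L) : up u 12 (st (L := L) D x (t+1)) =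
    max 0 (f0F u (st (L := L) D x t) + SF u (st (L := L) D x t) - 1) := by
  rw [up_eq]; simp [ulin, ubias]; ring_nf
lemma n13 (t : ℕ) (u : U L) : up u 13 (st (L := L) D x (t+1)) =
    max 0 ((pF u (st (L := L) D x t) - qF u (st (L := L) D x t)) / 2 - SF u (st (L := L) D x t)) := by
  rw [up_eq]; simp [ulin, ubias]; ring_nf
lemma n14 (t : ℕ) (u : U L) : up u 14 (st (L := L) D x (t+1)) =
    max 0 (-((pF u (st (L := L) D x t) - qF u (st (L := L) D x t)) / 2) - SF u (st (L := L) D x t)) := by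
  rw [up_eq]; simp [ulin, ubias]; ring_nf
lemma n15 (t : ℕ) (u : U L) : up u 15 (st (L := L) D x (t+1)) =
    max 0 (1 / 2 * y1F u (st (L := L) D x t) + SF u (st (L := L) D x t) - 1) := by
  rw [up_eq]; simp [ulin, ubias]; ring_nf
lemma n16 (t : ℕ) (u : U L) : up u 16 (st (L := L) D x (t+1)) =
    max 0 (y1F u (st (L := L) D x t) - 1 / 2 * cF u (st (L := L) D x t)
      + SF u (st (L := L) D x t) - 1) := by
  rw [up_eq]; simp [ulin, ubias]; ring_nf
lemma n17 (t : ℕ) (u : U L) : up u 17 (st (L := L) D x (t+1)) =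
    max 0 (f1F u (st (L := L) D x t) + SF u (st (L := L) D x t) - 1) := by
  rw [up_eq]; simp [ulin, ubias]; ring_nf

lemma load (t : ℕ) (u : U L) (hS : SF u (st (L := L) D x t) = 0) (hb : Bd (st (L := L) D x t) u)
    (hp : |pF u (st (L := L) D x t)| ≤ 1) (hq : |qF u (st (L := L) D x t)| ≤ 1) :
    Inv (st (L := L) D x (t+1)) u
      ((pF u (st (L := L) D x t) + qF u (st (L := L) D x t)) / 2)
      ((pF u (st (L := L) D x t) - qF u (st (L := L) D x t)) / 2) 0 := by
  obtain ⟨b1, b2, b3, b4, b5, b6, b7, b8, b9, b10⟩ := hb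
  have ec := c_eq D x t u
  have e8 := n8 D x t u
  have e9 := n9 D x t u
  have e10 := n10 D x t u
  have e11 := n11 D x t u
  have e12 := n12 D x t u
  have e13 := n13 D x t u
  have e14 := n14 D x t u
  have e15 := n15 D x t u
  have e16 := n16 D x t u
  have e17 := n17 D x t u
  rw [hS, sub_zero] at ec e8 e9 e13 e14
  rw [hS] at e10 e11 e12 e15 e16 e17
  rw [max_eq_left (by linarith)] at e10 e11 e12 e15 e16 e17
  rw [max_eq_left (by linarith), max_eq_right (by norm_num), zero_add] at ec
  have hy0 : y0F u (st (L := L) D x (t+1)) =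
    up u 8 (st (L := L) D x (t+1)) + up u 9 (st (L := L) D x (t+1)) := by
    simp [y0F, e10, e11]
  have hf0 : f0F u (st (L := L) D x (t+1)) =
    up u 8 (st (L := L) D x (t+1)) + up u 9 (st (L := L) D x (t+1)) := by
    simp [f0F, e10, e11, e12]
  have hy1 : y1F u (st (L := L) D x (t+1)) =
    up u 13 (st (L := L) D x (t+1)) + up u 14 (st (L := L) D x (t+1)) := by
    simp [y1F, e15, e16]
  have hf1 : f1F u (st (L := L) D x (t+1)) =
    up u 13 (st (L := L) D x (t+1)) + up u 14 (st (L := L) D x (t+1)) := by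
    simp [f1F, e15, e16, e17]
  rw [abs_le] at hp hq
  refine ⟨by rw [ec]; simp, ?_, ?_⟩
  · rw [ec, hy0, hf0, e8, e9]
    exact Sq.load (abs_le.2 ⟨by linarith, by linarith⟩)
  · rw [ec, hy1, hf1, e13, e14]
    exact Sq.load (abs_le.2 ⟨by linarith, by linarith⟩)

lemma run (t : ℕ) (u : U L) (hS : SF u (st (L := L) D x t) = 1) {a b : ℝ} {r : ℕ}
    (hi : Inv (st (L := L) D x t) u a b r)
    (hp : |pF u (st (L := L) D x t)| ≤ 1) (hq : |qF u (st (L := L) D x t)| ≤ 1) :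
    Inv (st (L := L) D x (t+1)) u a b (r+1) := by
  obtain ⟨b1, b2, b3, b4, b5, b6, b7, b8, b9, b10⟩ := hi.bd
  obtain ⟨i1, i2, i3⟩ := hi
  have hc : 0 < cF u (st (L := L) D x t) := by rw [i1]; positivity
  have ec := c_eq D x t u
  have e8 := n8 D x t u
  have e9 := n9 D x t u
  have e10 := n10 D x t u
  have e11 := n11 D x t u
  have e12 := n12 D x t u
  have e13 := n13 D x t u
  have e14 := n14 D x t u
  have e15 := n15 D x t u
  have e16 := n16 D x t u
  have e17 := n17 D x t u
  rw [abs_le] at hp hq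
  rw [hS, add_sub_cancel_right] at ec e10 e11 e12 e15 e16 e17
  rw [hS] at e8 e9 e13 e14
  rw [max_eq_left (by linarith)] at e8 e9 e13 e14
  rw [sub_self, max_self, add_zero, max_eq_right (by linarith)] at ec
  have ec' : cF u (st (L := L) D x (t+1)) = cF u (st (L := L) D x t) / 4 := by rw [ec]; ring
  have hy0 : y0F u (st (L := L) D x (t+1)) =
    up u 10 (st (L := L) D x (t+1)) - up u 11 (st (L := L) D x (t+1)) := by
    simp [y0F, e8, e9]
  have hf0 : f0F u (st (L := L) D x (t+1)) =
    up u 12 (st (L := L) D x (t+1)) - up u 10 (st (L := L) D x (t+1))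
      + up u 11 (st (L := L) D x (t+1)) := by
    simp [f0F, e8, e9]
  have hy1 : y1F u (st (L := L) D x (t+1)) =
    up u 15 (st (L := L) D x (t+1)) - up u 16 (st (L := L) D x (t+1)) := by
    simp [y1F, e13, e14]
  have hf1 : f1F u (st (L := L) D x (t+1)) =
    up u 17 (st (L := L) D x (t+1)) - up u 15 (st (L := L) D x (t+1))
      + up u 16 (st (L := L) D x (t+1)) := by
    simp [f1F, e13, e14]
  refine ⟨by rw [ec, i1, pow_succ]; ring, ?_, ?_⟩
  · rw [ec', hy0, hf0, e10, e11, e12]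
    exact i2.run hc
  · rw [ec', hy1, hf1, e15, e16, e17]
    exact i3.run hc

lemma v_bd (hx : |x / D| ≤ 1) (t : ℕ) (u : U L) (hb : Bd (st (L := L) D x t) u) :
    |vF u (st (L := L) D x t)| ≤ 1 := by
  unfold vF
  split_ifs with h
  · cases t with
    | zero => simp [st_zero]
    | succ t => rw [z_all]; exact hx
  · obtain ⟨b1, b2, b3, b4, b5, b6, b7, b8, b9, b10⟩ := hb
    rw [LinearMap.sub_apply, abs_le]
    constructor <;> linarith

lemma inv_all (hx : |x / D| ≤ 1) (t : ℕ) :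
    (∀ u : U L, Bd (st (L := L) D x t) u) ∧ (1 ≤ t → ∀ u : U L, ∃ a b r, Inv (st (L := L) D x t) u a b r) := by
  induction t with
  | zero =>
    refine ⟨fun u => by simp [Bd, st_zero], by simp⟩
  | succ t ih =>
    have key : ∀ u : U L, ∃ a b r, Inv (st (L := L) D x (t+1)) u a b r := by
      intro u
      have hp : |pF u (st (L := L) D x t)| ≤ 1 := v_bd D x hx t _ (ih.1 _)
      have hq : |qF u (st (L := L) D x t)| ≤ 1 := v_bd D x hx t _ (ih.1 _)
      rcases S_bin D x t u with hS | hS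
      · exact ⟨_, _, _, load D x t u hS (ih.1 u) hp hq⟩
      · have ht : 1 ≤ t := by
          rcases Nat.eq_zero_or_pos t with h | h
          · subst h; rw [S_zero] at hS; norm_num at hS
          · exact h
        obtain ⟨a, b, r, h⟩ := ih.2 ht u
        exact ⟨a, b, _, run D x t u hS h hp hq⟩
    refine ⟨fun u => ?_, fun _ => key⟩
    obtain ⟨a, b, r, h⟩ := key u
    exact h.bd

lemma v_le (hx : |x / D| ≤ 1) (t : ℕ) (u : U L) : |vF u (st (L := L) D x t)| ≤ 1 :=
  v_bd D x hx t u ((inv_all D x hx t).1 u)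

/-- Running for `r` steps after a load. -/
lemma track (hx : |x / D| ≤ 1) (t : ℕ) (u : U L) (hS : SF u (st (L := L) D x t) = 0) (r : ℕ)
    (hr : ∀ i, i < r → SF u (st (L := L) D x (t + 1 + i)) = 1) :
    Inv (st (L := L) D x (t + 1 + r)) u
      ((pF u (st (L := L) D x t) + qF u (st (L := L) D x t)) / 2)
      ((pF u (st (L := L) D x t) - qF u (st (L := L) D x t)) / 2) r := by
  induction r with
  | zero =>
    exact load D x t u hS ((inv_all D x hx t).1 u) (v_le D x hx t _) (v_le D x hx t _)
  | succ r ih =>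
    exact run D x (t + 1 + r) u (hr r (by omega)) (ih fun i hi => hr i (by omega))
      (v_le D x hx _ _) (v_le D x hx _ _)

lemma Inv.err {s : K L → ℝ} {u : U L} {p q : ℝ} {r : ℕ} (h : Inv s u ((p + q) / 2) ((p - q) / 2) r) :
    |f0F u s - f1F u s - p * q| ≤ (1/4:ℝ) ^ r / 4 := by
  obtain ⟨h1, h2, h3⟩ := h
  have hc : 0 < cF u s := by rw [h1]; positivity
  have a1 := h2.lower hc
  have a2 := h2.upper hc
  have a3 := h3.lower hc
  have a4 := h3.upper hc
  rw [h1] at a2 a4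
  rw [abs_le]
  constructor <;> nlinarith

end units

section main
variable (D x : ℝ)

lemma S_phase (κ m : ℕ) (h2 : 2 ≤ m) (hm : m ≤ 2 ^ κ + 1) (u : U L) :
    SF u (st (L := L) D x (2 ^ κ + m - 1)) =
      if Nat.log 2 u.2.val * 2 ^ κ + (u.1.val + 1) ≤ (u.1.val + 1) * m then 1 else 0 := by
  obtain ⟨m, rfl⟩ := Nat.exists_eq_add_of_le' h2
  have hc := clock_all (L := L) D x κ m (by omega)
  have hp : 0 < 2 ^ κ := Nat.two_pow_pos κ
  have := S_val D x hc u
  have e : 2 ^ κ + m - 1 + 2 = 2 ^ κ + (m + 2) - 1 := by omega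
  rw [e] at this
  rw [this]
  have e2 : (u.1.val + 1) * (m + 2) = (u.1.val + 1) * (m + 1) + (u.1.val + 1) := by ring
  rw [e2]
  simp only [Nat.add_le_add_iff_right]

lemma prod_err {p q a b e1 e2 : ℝ} (hp : |p| ≤ 1) (hb : |b| ≤ 1) (h1 : |p - a| ≤ e1)
    (h2 : |q - b| ≤ e2) : |p * q - a * b| ≤ e1 + e2 := by
  have : p * q - a * b = p * (q - b) + b * (p - a) := by ring
  rw [this]
  calc _ ≤ |p * (q - b)| + |b * (p - a)| := abs_add_le _ _
    _ = |p| * |q - b| + |b| * |p - a| := by rw [abs_mul, abs_mul]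
    _ ≤ 1 * |q - b| + 1 * |p - a| := by gcongr
    _ ≤ _ := by linarith

lemma err (hx : |x / D| ≤ 1) (κ P : ℕ) (l : Fin L) (hQ : 2 * (l.val + 1) ≤ 2 ^ κ)
    (hP : (l.val + 1) * (P + 1) ≤ 2 ^ κ) (i : ℕ) : ∀ (hi : i < 2 ^ (l.val + 1)) (n : ℕ),
    n ≤ 2 ^ κ → Nat.log 2 i * 2 ^ κ + (l.val + 1) * (P + 1) ≤ (l.val + 1) * n →
    |vF ⟨l, ⟨i, hi⟩⟩ (st (L := L) D x (2 ^ κ + n - 1)) - (x / D) ^ (i + 1)| ≤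
      (2 ^ (Nat.log 2 i + 1) - 1) * ((1/4:ℝ) ^ P / 4) := by
  induction i using Nat.strong_induction_on with
  | _ i ih =>
  intro hi n hn hl
  have hnP : P + 1 ≤ n := Nat.le_of_mul_le_mul_left (le_trans (Nat.le_add_left _ _) hl) (Nat.succ_pos _)
  have hQ2 : 2 ≤ 2 ^ κ := by omega
  have hε : (0:ℝ) ≤ (1/4:ℝ) ^ P / 4 := by positivity
  rcases Nat.lt_or_ge i 1 with h0 | h0
  · have : i = 0 := by omega
    subst this
    have e : 2 ^ κ + n - 1 = (2 ^ κ + n - 2) + 1 := by omega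
    rw [e]
    simp only [vF, if_true]
    rw [z_all]
    simpa using hε
  have hi0 : ¬ i = 0 := by omega
  simp only [vF, if_neg hi0, LinearMap.sub_apply]
  rcases Nat.lt_or_ge i 2 with h1 | h1
  · have : i = 1 := by omega
    subst this
    have hr : P ≤ 2 ^ κ + n - 3 := by omega
    have hS : ∀ j, j < 2 ^ κ + n - 3 → SF (⟨l, ⟨1, hi⟩⟩ : U L) (st (L := L) D x (1 + 1 + j)) = 1 := by
      intro j _
      obtain ⟨Q, n', h⟩ := clock_ex (L := L) D x j
      have := S_val D x h ⟨l, ⟨1, hi⟩⟩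
      rw [show 1 + 1 + j = j + 2 by omega, this]
      simp
    have hT := (track D x hx 1 ⟨l, ⟨1, hi⟩⟩ (S_one D x _) _ hS).err
    rw [show 1 + 1 + (2 ^ κ + n - 3) = 2 ^ κ + n - 1 by omega] at hT
    have hp : pF (⟨l, ⟨1, hi⟩⟩ : U L) (st (L := L) D x 1) = x / D := by
      simp only [pF, ch1, vF]; exact z_all D x 0
    have hq : qF (⟨l, ⟨1, hi⟩⟩ : U L) (st (L := L) D x 1) = x / D := by
      simp only [qF, ch2, vF]; exact z_all D x 0
    rw [hp, hq] at hT
    have hpow : (1/4:ℝ) ^ (2 ^ κ + n - 3) ≤ (1/4:ℝ) ^ P :=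
      pow_le_pow_of_le_one (by norm_num) (by norm_num) hr
    have : (x / D) ^ (1 + 1) = x / D * (x / D) := by ring
    rw [this]
    refine hT.trans ?_
    norm_num
    norm_num at hpow
    linarith
  -- general case
  set g := Nat.log 2 i with hg
  have hg1 : 1 ≤ g := Nat.log_pos (by norm_num) h1
  have hlog1 : Nat.log 2 (i / 2) = g - 1 := by rw [Nat.log_div_base]
  have hlog2 : Nat.log 2 ((i - 1) / 2) ≤ g - 1 := by
    rw [← hlog1]; exact Nat.log_mono_right (Nat.div_le_div_right (by omega))
  have hgQ : (g - 1) * 2 ^ κ + 2 ^ κ = g * 2 ^ κ := by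
    obtain ⟨g', hg'⟩ := Nat.exists_eq_add_of_le' hg1
    rw [hg']; simp; ring
  have hex : ∃ m, g * 2 ^ κ + (l.val + 1) ≤ (l.val + 1) * m :=
    ⟨n, le_trans (by nlinarith [Nat.zero_le P, Nat.zero_le l.val]) hl⟩
  classical
  set n1 := Nat.find hex with hn1
  have s1 : g * 2 ^ κ + (l.val + 1) ≤ (l.val + 1) * n1 := Nat.find_spec hex
  have s2 : ∀ m, m < n1 → ¬ (g * 2 ^ κ + (l.val + 1) ≤ (l.val + 1) * m) :=
    fun m hm => Nat.find_min hex hm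
  have s3 : n1 + P ≤ n := by
    have : n1 ≤ n - P := by
      apply Nat.find_min' hex
      have : (l.val + 1) * n = (l.val + 1) * (n - P) + (l.val + 1) * P := by
        rw [← Nat.mul_add]; congr 1; omega
      have e : (l.val + 1) * (P + 1) = (l.val + 1) * P + (l.val + 1) := by ring
      omega
    omega
  have s4 : 3 ≤ n1 := by
    have : (l.val + 1) * 3 ≤ (l.val + 1) * n1 := by omega
    exact Nat.le_of_mul_le_mul_left this (Nat.succ_pos _)
  let u : U L := ⟨l, ⟨i, hi⟩⟩
  have hS0 : SF u (st (L := L) D x (2 ^ κ + (n1 - 1) - 1)) = 0 := by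
    rw [S_phase D x κ (n1 - 1) (by omega) (by omega)]
    exact if_neg (s2 _ (by omega))
  have hS1 : ∀ j, j < n - n1 → SF u (st (L := L) D x (2 ^ κ + (n1 - 1) - 1 + 1 + j)) = 1 := by
    intro j hj
    rw [show 2 ^ κ + (n1 - 1) - 1 + 1 + j = 2 ^ κ + (n1 + j) - 1 by omega,
      S_phase D x κ (n1 + j) (by omega) (by omega)]
    exact if_pos (s1.trans (Nat.mul_le_mul_left _ (by omega)))
  have hT := (track D x hx _ u hS0 _ hS1).err
  rw [show 2 ^ κ + (n1 - 1) - 1 + 1 + (n - n1) = 2 ^ κ + n - 1 by omega] at hT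
  have hl1 : (l.val + 1) * n1 = (l.val + 1) * (n1 - 1) + (l.val + 1) := by
    rw [← Nat.mul_succ]; congr 1; omega
  have c1 := ih (i / 2) (by omega) (ch1 u).2.2 (n1 - 1) (by omega) (by rw [hlog1]; omega)
  have c2 := ih ((i - 1) / 2) (by omega) (ch2 u).2.2 (n1 - 1) (by omega)
    (by have := Nat.mul_le_mul_right (2 ^ κ) hlog2; omega)
  rw [hlog1, Nat.sub_add_cancel hg1] at c1
  have c2' : |vF (ch2 u) (st (L := L) D x (2 ^ κ + (n1 - 1) - 1)) - (x / D) ^ ((i - 1) / 2 + 1)| ≤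
      (2 ^ g - 1) * ((1/4:ℝ) ^ P / 4) := by
    refine le_trans c2 ?_
    gcongr
    · norm_num
    · omega
  have c1' : |vF (ch1 u) (st (L := L) D x (2 ^ κ + (n1 - 1) - 1)) - (x / D) ^ (i / 2 + 1)| ≤
      (2 ^ g - 1) * ((1/4:ℝ) ^ P / 4) := c1
  have hz : |(x / D) ^ ((i - 1) / 2 + 1)| ≤ 1 := by
    rw [abs_pow]; exact pow_le_one₀ (abs_nonneg _) hx
  have hpe := prod_err (v_le D x hx _ _) hz c1' c2'
  rw [← pow_add, show i / 2 + 1 + ((i - 1) / 2 + 1) = i + 1 by omega] at hpe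
  have hpow : (1/4:ℝ) ^ (n - n1) ≤ (1/4:ℝ) ^ P :=
    pow_le_pow_of_le_one (by norm_num) (by norm_num) (by omega)
  have tri := abs_sub_le (f0F u (st (L := L) D x (2 ^ κ + n - 1)) - f1F u (st (L := L) D x (2 ^ κ + n - 1)))
    (vF (ch1 u) (st (L := L) D x (2 ^ κ + (n1 - 1) - 1)) *
      vF (ch2 u) (st (L := L) D x (2 ^ κ + (n1 - 1) - 1))) ((x / D) ^ (i + 1))
  refine tri.trans ((add_le_add hT hpe).trans ?_)
  rw [pow_succ (2:ℝ) g]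
  nlinarith

def ou (hL : 1 ≤ L) (o : Fin (2 ^ L)) : U L :=
  ⟨⟨Nat.log 2 o.val, by
    rcases Nat.eq_zero_or_pos o.val with h | h
    · rw [h, Nat.log_zero_right]; omega
    · exact Nat.log_lt_of_lt_pow (by omega) o.2⟩,
   ⟨o.val, Nat.lt_pow_succ_log_self (by norm_num) _⟩⟩

/-- The network on structured index types. -/
noncomputable def net (hL : 1 ≤ L) (D : ℝ) : RNN (Fin 1) (K L) (Fin (2 ^ L)) where
  Ah := LinearMap.toMatrix' lin
  Ax := fun k _ => inp D k
  Ao := LinearMap.toMatrix' (LinearMap.pi fun o => D ^ (o.val + 1) • vF (ou hL o))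
  bh := bias
  bo := 0

lemma net_hid (hL : 1 ≤ L) (t : ℕ) : (net hL D).hid (fun _ => x) t = st D x (t+1) := by
  induction t with
  | zero =>
    funext k
    simp [RNN.hid, net, relu, st, Matrix.mulVec, dotProduct, add_comm]
  | succ t ih =>
    rw [RNN.hid, ih]
    funext k
    simp [net, relu, st.eq_def D x (t+2), LinearMap.toMatrix'_mulVec]

lemma net_out (hL : 1 ≤ L) (t : ℕ) (o : Fin (2 ^ L)) :
    (net hL D).out (fun _ => x) t o = D ^ (o.val + 1) * vF (ou hL o) (st D x (t+1)) := by
  rw [RNN.out, net_hid]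
  simp [net, LinearMap.toMatrix'_mulVec]

lemma card_K : Fintype.card (K L) ≤ 40 * 2 ^ L := by
  have h : ∑ l : Fin L, 2 ^ (l.val + 1) + 2 = 2 * 2 ^ L := by
    rw [Fin.sum_univ_eq_sum_range (fun l => 2 ^ (l + 1)) L]
    induction L with
    | zero => simp
    | succ n ih => rw [Finset.sum_range_succ, pow_succ]; omega
  simp only [K, Fintype.card_sum, Fintype.card_prod, Fintype.card_sigma, Fintype.card_fin]
  omega

/-- Transport of a network along an equivalence of hidden indices. -/
def reidx {ι κ κ' ω : Type} (e : κ' ≃ κ) (R : RNN ι κ ω) : RNN ι κ' ω where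
  Ah := fun i j => R.Ah (e i) (e j)
  Ax := fun i j => R.Ax (e i) j
  Ao := fun i j => R.Ao i (e j)
  bh := fun i => R.bh (e i)
  bo := R.bo

lemma reidx_hid {ι κ κ' ω : Type} [Fintype ι] [Fintype κ] [Fintype κ'] (e : κ' ≃ κ) (R : RNN ι κ ω)
    (v : ι → ℝ) (t : ℕ) (i : κ') : (reidx e R).hid v t i = R.hid v t (e i) := by
  induction t generalizing i with
  | zero => rfl
  | succ t ih =>
    simp only [RNN.hid, relu, Pi.add_apply, Matrix.mulVec, dotProduct, reidx]
    congr 2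
    rw [← Equiv.sum_comp e]
    exact Finset.sum_congr rfl fun j _ => by rw [← ih j]; rfl

lemma reidx_out {ι κ κ' ω : Type} [Fintype ι] [Fintype κ] [Fintype κ'] (e : κ' ≃ κ) (R : RNN ι κ ω)
    (v : ι → ℝ) (t : ℕ) : (reidx e R).out v t = R.out v t := by
  funext o
  simp only [RNN.out, Pi.add_apply, Matrix.mulVec, dotProduct]
  congr 1
  rw [← Equiv.sum_comp e]
  exact Finset.sum_congr rfl fun j _ => by rw [← reidx_hid]; rfl

lemma final_bound (k l P : ℕ) (hl : 1 ≤ l) (hP : 2 ^ k < l * (P + 2)) :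
    (2 ^ l - 1) * ((1/4:ℝ) ^ P / 4) ≤
      8 * 2 ^ l * (4 : ℝ) ^ (-(1 / (2 * (l : ℝ))) * (2 : ℝ) ^ (k + 1)) := by
  have hl' : (0:ℝ) < l := by exact_mod_cast hl
  have e : -(1 / (2 * (l : ℝ))) * (2 : ℝ) ^ (k + 1) = -((2:ℝ) ^ k / l) := by
    rw [pow_succ]; field_simp
  have hP' : (2:ℝ) ^ k / l ≤ P + 2 := by
    rw [div_le_iff₀ hl', mul_comm]; exact_mod_cast hP.le
  have h1 : (1/4:ℝ) ^ P / 16 ≤ (4 : ℝ) ^ (-((2:ℝ) ^ k / l)) := by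
    have : (1/4:ℝ) ^ P / 16 = (4:ℝ) ^ (-((P:ℝ) + 2)) := by
      rw [Real.rpow_neg (by norm_num), show ((P:ℝ) + 2) = ((P + 2 : ℕ) : ℝ) by push_cast; ring,
        Real.rpow_natCast, pow_add, one_div, inv_pow, mul_inv]
      norm_num
      ring
    rw [this]
    exact Real.rpow_le_rpow_of_exponent_le (by norm_num) (by linarith)
  rw [e]
  have h2 : (0:ℝ) < (1/4:ℝ) ^ P := by positivity
  have h3 : (0:ℝ) < 2 ^ l := by positivity
  calc (2 ^ l - 1) * ((1/4:ℝ) ^ P / 4) ≤ 2 ^ l * ((1/4:ℝ) ^ P / 4) := by gcongr; linarith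
    _ ≤ 8 * 2 ^ l * ((1/4:ℝ) ^ P / 16) := by nlinarith [mul_pos h3 h2]
    _ ≤ _ := by gcongr

end main

end PowNet

/-- Theorem (RNN computing all powers up to `2^L`): for `L ∈ ℕ` and `D ≥ 1` there is an
RNN with input dimension 1, output dimension `2^L`, and hidden state size at most
`40·2^L` such that for all `x ∈ [−D, D]` and all `k ≥ ⌈log₂ L⌉ + 2`, the first output
component at time `2^k − 2` equals `x`, and for every `ℓ ∈ {1,…,L}`, `j ∈ {1,…,2^{ℓ−1}}`,
the output component with 1-based index `2^{ℓ−1}+j` approximates `x^{2^{ℓ−1}+j}` to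
within `ε_{ℓ,k} = 8·2^ℓ·D^{2^ℓ}·4^{−(1/(2ℓ))·2^k}`. -/
theorem stmt17 (L : ℕ) (hL : 1 ≤ L) (D : ℝ) (hD : 1 ≤ D) :
    ∃ (mh : ℕ) (R : RNN (Fin 1) (Fin mh) (Fin (2 ^ L))),
      mh ≤ 40 * 2 ^ L ∧
      ∀ x : ℝ, x ∈ Set.Icc (-D) D → ∀ k : ℕ, Nat.clog 2 L + 2 ≤ k →
        R.out (fun _ => x) (2 ^ k - 2) ⟨0, Nat.two_pow_pos L⟩ = x ∧
        ∀ l : ℕ, 1 ≤ l → l ≤ L → ∀ j : ℕ, 1 ≤ j → j ≤ 2 ^ (l - 1) →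
          ∀ hij : 2 ^ (l - 1) + j - 1 < 2 ^ L,
            |R.out (fun _ => x) (2 ^ k - 2) ⟨2 ^ (l - 1) + j - 1, hij⟩
                - x ^ (2 ^ (l - 1) + j)| ≤
              8 * 2 ^ l * D ^ (2 ^ l) *
                (4 : ℝ) ^ (-(1 / (2 * (l : ℝ))) * (2 : ℝ) ^ k) := by
  classical
  refine ⟨Fintype.card (PowNet.K L),
    PowNet.reidx (Fintype.equivFin (PowNet.K L)).symm (PowNet.net hL D), PowNet.card_K, ?_⟩
  intro x hx k hk
  have hD0 : (0:ℝ) < D := by linarith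
  have hxD : |x / D| ≤ 1 := by
    rw [abs_div, abs_of_pos hD0, div_le_one hD0]
    exact abs_le.2 hx
  obtain ⟨κ, rfl⟩ : ∃ κ, k = κ + 1 := ⟨k - 1, by omega⟩
  have hQ : 2 * L ≤ 2 ^ κ := by
    have h1 : L ≤ 2 ^ Nat.clog 2 L := Nat.le_pow_clog (by norm_num) L
    have h2 : 2 ^ (Nat.clog 2 L + 1) ≤ 2 ^ κ := Nat.pow_le_pow_right (by norm_num) (by omega)
    rw [pow_succ] at h2
    omega
  have hT : 2 ^ (κ + 1) - 2 + 1 = 2 ^ κ + 2 ^ κ - 1 := by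
    have : 0 < 2 ^ κ := Nat.two_pow_pos κ
    rw [pow_succ]; omega
  rw [PowNet.reidx_out]
  constructor
  · rw [PowNet.net_out]
    have : PowNet.vF (PowNet.ou hL ⟨0, Nat.two_pow_pos L⟩)
        (PowNet.st D x (2 ^ (κ + 1) - 2 + 1)) = x / D := by
      simp only [PowNet.vF, PowNet.ou, if_true]
      exact PowNet.z_all D x _
    rw [this]
    simp only [zero_add, pow_one]
    field_simp
  · intro l hl1 hlL j hj1 hj2 hij
    rw [PowNet.net_out, hT]
    obtain ⟨g, rfl⟩ : ∃ g, l = g + 1 := ⟨l - 1, by omega⟩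
    simp only [Nat.add_sub_cancel] at hj2 hij ⊢
    have hpos : 0 < 2 ^ g := Nat.two_pow_pos g
    suffices key : ∀ (i : ℕ) (hij : i < 2 ^ L), 2 ^ g + j = i + 1 →
        |D ^ (i + 1) * PowNet.vF (PowNet.ou hL ⟨i, hij⟩) (PowNet.st D x (2 ^ κ + 2 ^ κ - 1))
          - x ^ (i + 1)| ≤ 8 * 2 ^ (g + 1) * D ^ (2 ^ (g + 1)) *
            (4 : ℝ) ^ (-(1 / (2 * ((g + 1 : ℕ) : ℝ))) * (2 : ℝ) ^ (κ + 1)) by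
      have e : x ^ (2 ^ g + j) = x ^ (2 ^ g + j - 1 + 1) := by congr 1; omega
      rw [e]
      exact key _ hij (by omega)
    clear hij
    intro i hij hip
    have hlog : Nat.log 2 i = g := by
      rw [Nat.log_eq_iff (Or.inr ⟨by norm_num, by omega⟩)]
      rw [pow_succ]
      omega
    set Q := 2 ^ κ with hQdef
    have hdiv : 2 ≤ Q / (g + 1) := by
      rw [Nat.le_div_iff_mul_le (Nat.succ_pos g)]; omega
    obtain ⟨P, hP⟩ : ∃ P, Q / (g + 1) = P + 1 := ⟨Q / (g + 1) - 1, by omega⟩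
    have hP1 : (g + 1) * (P + 1) ≤ Q := by rw [← hP]; exact Nat.mul_div_le _ _
    have hP2 : Q < (g + 1) * (P + 2) := by
      have := Nat.lt_mul_div_succ Q (Nat.succ_pos g)
      rw [Nat.succ_eq_add_one, hP] at this
      exact this
    have he := PowNet.err D x hxD κ P (PowNet.ou hL ⟨i, hij⟩).1
      (by simp only [PowNet.ou, hlog]; omega) (by simp only [PowNet.ou, hlog]; exact hP1) i
      (PowNet.ou hL ⟨i, hij⟩).2.2 Q le_rfl
      (by
        simp only [PowNet.ou, hlog]
        have e : (g + 1) * Q = g * Q + Q := by ring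
        rw [e]
        exact Nat.add_le_add_left hP1 _)
    have he' : |PowNet.vF (PowNet.ou hL ⟨i, hij⟩) (PowNet.st D x (Q + Q - 1)) - (x / D) ^ (i + 1)| ≤
      (2 ^ (Nat.log 2 i + 1) - 1) * ((1/4:ℝ) ^ P / 4) := he
    rw [hlog] at he'
    have hb := PowNet.final_bound κ (g + 1) P (by omega) hP2
    have hDp : D ^ (i + 1) ≤ D ^ (2 ^ (g + 1)) :=
      pow_le_pow_right₀ hD (by rw [pow_succ]; omega)
    have hx' : x ^ (i + 1) = D ^ (i + 1) * (x / D) ^ (i + 1) := by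
      rw [← mul_pow]; congr 1; field_simp
    rw [hx', ← mul_sub, abs_mul, abs_of_pos (pow_pos hD0 _)]
    calc _ ≤ D ^ (2 ^ (g + 1)) * (8 * 2 ^ (g + 1) *
          (4 : ℝ) ^ (-(1 / (2 * ((g + 1 : ℕ) : ℝ))) * (2 : ℝ) ^ (κ + 1))) :=
          mul_le_mul hDp (he'.trans hb) (abs_nonneg _) (by positivity)
      _ = _ := by ring
end

section
/- Let N ∈ ℕ, D >= 1, and a_0, a_1, ..., a_N ∈ ℝ. There exists an RNN R with input dimension 1, output dimension 1, and hidden state size at most 80N + 11 such that for all x ∈ [-D, D] and all t >= 16·log N: |(R D x)[t] - sum_{i=0}^N a_i x^i| <= ‖a‖_1 · C_1 · 4^{-C_2·t}, where C_1 = 16·N·D^{2N}, C_2 = 1/(4⌈log N⌉), and ‖a‖_1 = sum_{i=0}^N |a_i|. -/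
/-! ## One-layer systems and their realization by an RNN -/

def Aff {S : Type} [Fintype S] (l : (S → ℝ) → ℝ) : Prop :=
  ∃ (B : S → ℝ) (β : ℝ), ∀ y, l y = ∑ s, B s * y s + β

def IsLay {S : Type} [Fintype S] (n : ℕ) (f : (S → ℝ) → ℝ) : Prop :=
  ∃ (c : ℝ) (α β : Fin n → ℝ) (B : Fin n → S → ℝ),
    ∀ y, f y = c + ∑ i, α i * max 0 (∑ s, B i s * y s + β i)

section closure
variable {S : Type} [Fintype S]

lemma Aff.const (c : ℝ) : Aff (fun _ : S → ℝ => c) := ⟨0, c, by simp⟩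

lemma Aff.coord [DecidableEq S] (s : S) : Aff (fun y : S → ℝ => y s) :=
  ⟨fun s' => if s' = s then 1 else 0, 0, by simp⟩

lemma Aff.add {f g : (S → ℝ) → ℝ} (hf : Aff f) (hg : Aff g) : Aff (fun y => f y + g y) := by
  obtain ⟨B, β, h⟩ := hf
  obtain ⟨B', β', h'⟩ := hg
  refine ⟨fun s => B s + B' s, β + β', fun y => ?_⟩
  simp only [h, h']
  simp only [add_mul, Finset.sum_add_distrib]
  ring

lemma Aff.smul {f : (S → ℝ) → ℝ} (a : ℝ) (hf : Aff f) : Aff (fun y => a * f y) := by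
  obtain ⟨B, β, h⟩ := hf
  refine ⟨fun s => a * B s, a * β, fun y => ?_⟩
  simp only [h]
  simp only [mul_add, Finset.mul_sum, mul_assoc]

lemma Aff.neg {f : (S → ℝ) → ℝ} (hf : Aff f) : Aff (fun y => - f y) := by
  have := hf.smul (-1)
  simpa using this

lemma Aff.sub {f g : (S → ℝ) → ℝ} (hf : Aff f) (hg : Aff g) : Aff (fun y => f y - g y) := by
  have := hf.add hg.neg
  simpa [sub_eq_add_neg] using this

lemma Aff.sum {ι : Type} (I : Finset ι) (f : ι → (S → ℝ) → ℝ) (h : ∀ i, Aff (f i)) :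
    Aff (fun y => ∑ i ∈ I, f i y) := by
  classical
  induction I using Finset.induction_on with
  | empty => simpa using Aff.const (S := S) 0
  | insert a I ha ih =>
    simp only [Finset.sum_insert ha]
    exact (h a).add ih

lemma IsLay.const (n : ℕ) (c : ℝ) : IsLay n (fun _ : S → ℝ => c) := ⟨c, 0, 0, 0, by simp⟩

lemma IsLay.cons {n : ℕ} {f l : (S → ℝ) → ℝ} (a : ℝ) (hf : IsLay n f) (hl : Aff l) :
    IsLay (n + 1) (fun y => f y + a * max 0 (l y)) := by
  obtain ⟨c, α, β, B, h⟩ := hf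
  obtain ⟨B', β', h'⟩ := hl
  refine ⟨c, Fin.snoc α a, Fin.snoc β β', Fin.snoc (α := fun _ => S → ℝ) B B', fun y => ?_⟩
  simp only [h, h']
  rw [Fin.sum_univ_castSucc]
  simp [add_assoc]

/-- Realization of a one-layer system. -/
lemma realize (F : (S → ℝ) → (S → ℝ)) (n : ℕ) (hF : ∀ s, IsLay n (fun y => F y s))
    (X c0 : S → ℝ) (so : S) :
    ∃ R : RNN (Fin 1) (Fin (Fintype.card S * n + 1)) (Fin 1),
      ∀ (x : ℝ) (t : ℕ), R.out (fun _ => x) t 0 = (F^[t+1] (fun s => X s * x + c0 s)) so := by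
  classical
  choose c α β B h using hF
  let κ := (S × Fin n) ⊕ Unit
  have hc : Fintype.card κ = Fintype.card S * n + 1 := by simp [κ]
  let e : Fin (Fintype.card S * n + 1) ≃ κ := (Fintype.equivFinOfCardEq hc).symm
  -- `C` : state from hidden; `Bm` : hidden preactivation from state.
  let C : S → κ → ℝ := fun s => Sum.elim (fun q => if q.1 = s then α s q.2 else 0) (fun _ => c s - c0 s)
  let Bm : κ → S → ℝ := Sum.elim (fun q => B q.1 q.2) (fun _ => 0)
  let bb : κ → ℝ := Sum.elim (fun q => β q.1 q.2) (fun _ => 1)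
  let R : RNN (Fin 1) (Fin (Fintype.card S * n + 1)) (Fin 1) :=
    { Ah := fun i i' => ∑ s, Bm (e i) s * C s (e i')
      Ax := fun i _ => ∑ s, Bm (e i) s * X s
      Ao := fun _ i => C so (e i)
      bh := fun i => ∑ s, Bm (e i) s * c0 s + bb (e i)
      bo := fun _ => c0 so }
  refine ⟨R, fun x t => ?_⟩
  have hstep : ∀ (y : S → ℝ) s, F y s =
      ∑ i, C s (e i) * max 0 (∑ s', Bm (e i) s' * y s' + bb (e i)) + c0 s := by
    intro y s
    rw [e.sum_comp (fun k => C s k * max 0 (∑ s', Bm k s' * y s' + bb k))]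
    rw [Fintype.sum_sum_type, Fintype.sum_prod_type, show F y s = _ from h s y]
    simp [C, Bm, bb, ite_mul, Finset.sum_ite_irrel]
    ring
  have hh : ∀ t i, R.hid (fun _ => x) t i =
      max 0 (∑ s', Bm (e i) s' * (F^[t] (fun s => X s * x + c0 s)) s' + bb (e i)) := by
    intro t
    induction t with
    | zero =>
      intro i
      simp only [RNN.hid, relu, Matrix.mulVec, dotProduct, Pi.add_apply, R, Function.iterate_zero, id]
      congr 1
      simp only [Finset.univ_unique, Finset.sum_singleton, Finset.sum_mul, mul_add,
        Finset.sum_add_distrib, mul_assoc]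
      ring
    | succ t ih =>
      intro i
      simp only [RNN.hid, relu, Matrix.mulVec, dotProduct, Pi.add_apply]
      simp only [ih, Function.iterate_succ_apply', hstep (F^[t] _)]
      congr 1
      simp only [R, mul_add, Finset.sum_add_distrib, Finset.sum_mul, Finset.mul_sum]
      rw [Finset.sum_comm]
      simp only [mul_assoc, add_assoc]
  simp only [RNN.out, Matrix.mulVec, dotProduct, Pi.add_apply, hh, Function.iterate_succ_apply',
    hstep (F^[t] _)]
  rfl

end closure

/-! ## The clock -/

structure Clk (L : ℕ) (q0 q1 d p j : ℕ → ℝ) : Prop where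
  hq0 : ∀ t, q0 (t+1) = 0 + 1 * max 0 (q0 t) + (-1) * max 0 (1 - d t - p t)
    + 1 * max 0 (d t - p t) + 1 * max 0 (d t + j t - (L - 1))
  hq1 : ∀ t, q1 (t+1) = 0 + 1 * max 0 (q1 t) + (-1) * max 0 (d t - p t)
    + 1 * max 0 (1 - d t - p t) + 1 * max 0 (1 - d t + j t - (L - 1))
  hd : ∀ t, d (t+1) = 0 + 1 * max 0 (d t - p t) + 1 * max 0 (p t - d t)
  hp : ∀ t, p (t+1) = 0 + 1 * max 0 (2 - q0 t - 2 * d t) + (-2) * max 0 (1 - q0 t - 2 * d t)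
    + 1 * max 0 (2 * d t - q1 t) + (-2) * max 0 (2 * d t - 1 - q1 t)
  hj : ∀ t, j (t+1) = 0 + 1 * max 0 (j t) + 1 * max 0 (p t) + (-(L:ℝ)) * max 0 (j t + p t - (L - 1))

def PS (q0 q1 d p j : ℕ → ℝ) (n M J : ℕ) : Prop :=
  p n = 0 ∧ j n = J ∧ ((d n = 0 ∧ q0 n = M ∧ q1 n = 0) ∨ (d n = 1 ∧ q1 n = M ∧ q0 n = 0))

lemma clk_mid {L : ℕ} {q0 q1 d p j : ℕ → ℝ} (H : Clk L q0 q1 d p j) {n M J : ℕ}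
    (hPS : PS q0 q1 d p j n M J) (hM : 1 ≤ M) (hJ : J < L) (s : ℕ) (hs : s ≤ M) :
    p (n+s) = (if s = M then 1 else 0) ∧ j (n+s) = J ∧
    ((d (n+s) = 0 ∧ q0 (n+s) = M - s ∧ q1 (n+s) = (if J + 1 = L then 2 else 1) * s) ∨
     (d (n+s) = 1 ∧ q1 (n+s) = M - s ∧ q0 (n+s) = (if J + 1 = L then 2 else 1) * s)) := by
  have hJL : (J:ℝ) + 1 ≤ L := by exact_mod_cast hJ
  have hJ0 : (0:ℝ) ≤ J := by positivity
  induction s with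
  | zero =>
    obtain ⟨h1, h2, h3⟩ := hPS
    have : ¬ (0 = M) := by omega
    simpa [h1, h2, this] using h3
  | succ s ih =>
    obtain ⟨h1, h2, h3⟩ := ih (by omega)
    have hsM : ¬ (s = M) := by omega
    rw [if_neg hsM] at h1
    have hsM' : (s:ℝ) + 1 ≤ M := by exact_mod_cast hs
    have hs0 : (0:ℝ) ≤ s := by positivity
    have hJe : max 0 (1 + (J:ℝ) - (L - 1)) = (if J + 1 = L then 2 else 1) - 1 := by
      split_ifs with h
      · have : (J:ℝ) + 1 = L := by exact_mod_cast h
        rw [max_eq_right] <;> linarith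
      · have : (J:ℝ) + 1 + 1 ≤ L := by exact_mod_cast (show J + 1 + 1 ≤ L by omega)
        rw [max_eq_left] <;> linarith
    have hJz : max 0 (0 + (J:ℝ) - (L - 1)) = 0 := by
      rw [max_eq_left]; linarith
    have hdet : max 0 (2 - ((M:ℝ) - s)) - 2 * max 0 (1 - ((M:ℝ) - s)) = if s + 1 = M then 1 else 0 := by
      rw [max_eq_left (b := 1 - ((M:ℝ) - s)) (by linarith)]
      split_ifs with h
      · have : (s:ℝ) + 1 = M := by exact_mod_cast h
        rw [max_eq_right] <;> linarith
      · have : (s:ℝ) + 1 + 1 ≤ M := by exact_mod_cast (show s + 1 + 1 ≤ M by omega)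
        rw [max_eq_left] <;> linarith
    have hr : (0:ℝ) ≤ (if J + 1 = L then 2 else 1) * s := by
      split_ifs <;> positivity
    set e : ℝ := (if J + 1 = L then 2 else 1) with he
    have hjj : j (n + s + 1) = J := by
      rw [H.hj, h1, h2, max_eq_right hJ0, max_self, max_eq_left (b := (J:ℝ) + 0 - (L - 1)) (by linarith)]
      ring
    rw [← add_assoc]
    rcases h3 with ⟨hd, ha, hb⟩ | ⟨hd, ha, hb⟩
    · refine ⟨?_, hjj, Or.inl ⟨?_, ?_, ?_⟩⟩
      · rw [H.hp, hd, ha, hb, ← hdet, max_eq_left (b := 2 * 0 - e * (s:ℝ)) (by linarith),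
          max_eq_left (b := 2 * 0 - 1 - e * (s:ℝ)) (by linarith)]
        simp only [mul_zero, sub_zero]
        ring
      · rw [H.hd, hd, h1]; simp
      · rw [H.hq0, hd, ha, h1, h2, hJz, max_eq_right (by linarith)]
        push_cast
        norm_num
        ring
      · rw [H.hq1, hd, hb, h1, h2, max_eq_right hr, sub_zero (1:ℝ), hJe]
        push_cast
        norm_num
        ring
    · refine ⟨?_, hjj, Or.inr ⟨?_, ?_, ?_⟩⟩
      · rw [H.hp, hd, ha, hb, ← hdet, max_eq_left (b := 2 - e * (s:ℝ) - 2 * 1) (by linarith),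
          max_eq_left (b := 1 - e * (s:ℝ) - 2 * 1) (by linarith)]
        ring_nf
      · rw [H.hd, hd, h1]; simp
      · rw [H.hq1, hd, ha, h1, h2, sub_self (1:ℝ), hJz, max_eq_right (by linarith)]
        push_cast
        norm_num
        ring
      · rw [H.hq0, hd, hb, h1, h2, max_eq_right hr, hJe]
        push_cast
        norm_num
        ring

lemma clk_next {L : ℕ} {q0 q1 d p j : ℕ → ℝ} (H : Clk L q0 q1 d p j) {n M J : ℕ}
    (hPS : PS q0 q1 d p j n M J) (hM : 1 ≤ M) (hJ : J < L) :
    PS q0 q1 d p j (n + M + 1) (if J + 1 = L then 2 * M + 1 else M)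
      (if J + 1 = L then 0 else J + 1) := by
  have hJL : (J:ℝ) + 1 ≤ L := by exact_mod_cast hJ
  have hJ0 : (0:ℝ) ≤ J := by positivity
  have hM1 : (1:ℝ) ≤ M := by exact_mod_cast hM
  obtain ⟨h1, h2, h3⟩ := clk_mid H hPS hM hJ M le_rfl
  rw [if_pos rfl] at h1
  rw [sub_self] at h3
  have hjj : j (n + M + 1) = ((if J + 1 = L then 0 else J + 1 : ℕ) : ℝ) := by
    rw [H.hj, h1, h2, max_eq_right hJ0]
    split_ifs with h
    · have : (J:ℝ) + 1 = L := by exact_mod_cast h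
      rw [max_eq_right (by norm_num), max_eq_right (by linarith), ← this]
      push_cast; ring
    · have : (J:ℝ) + 1 + 1 ≤ L := by exact_mod_cast (show J + 1 + 1 ≤ L by omega)
      rw [max_eq_right (by norm_num), max_eq_left (by linarith)]
      push_cast; ring
  have hJz : max 0 (0 + (J:ℝ) - (L - 1)) = 0 := by
    rw [max_eq_left]; linarith
  have hq : 0 + 1 * max 0 ((if J + 1 = L then 2 else 1) * (M:ℝ)) + 1 * max 0 (1 + (J:ℝ) - (L-1))
      = ((if J + 1 = L then 2 * M + 1 else M : ℕ) : ℝ) := by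
    split_ifs with h
    · have : (J:ℝ) + 1 = L := by exact_mod_cast h
      rw [max_eq_right (by linarith), max_eq_right (by linarith), ← this]
      push_cast; ring
    · have : (J:ℝ) + 1 + 1 ≤ L := by exact_mod_cast (show J + 1 + 1 ≤ L by omega)
      rw [max_eq_right (by linarith), max_eq_left (by linarith)]
      ring
  refine ⟨?_, hjj, ?_⟩
  · rw [H.hp]
    rcases h3 with ⟨hd, ha, hb⟩ | ⟨hd, ha, hb⟩
    · have : (0:ℝ) ≤ (if J + 1 = L then 2 else 1) * M := by split_ifs <;> linarith
      rw [ha, hd, hb]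
      rw [max_eq_left (b := 2 * 0 - _ * (M:ℝ)) (by linarith), max_eq_left (b := 2 * 0 - 1 - _ * (M:ℝ)) (by linarith)]
      norm_num
    · have : (0:ℝ) ≤ (if J + 1 = L then 2 else 1) * M := by split_ifs <;> linarith
      rw [ha, hd, hb]
      rw [max_eq_left (b := 2 - _ * (M:ℝ) - 2 * 1) (by linarith), max_eq_left (b := 1 - _ * (M:ℝ) - 2 * 1) (by linarith)]
      norm_num
  · rcases h3 with ⟨hd, ha, hb⟩ | ⟨hd, ha, hb⟩
    · refine Or.inr ⟨?_, ?_, ?_⟩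
      · rw [H.hd, hd, h1]; norm_num
      · rw [H.hq1, hd, hb, h1, h2, ← hq]; norm_num
      · rw [H.hq0, hd, ha, h1, h2, hJz]; norm_num
    · refine Or.inl ⟨?_, ?_, ?_⟩
      · rw [H.hd, hd, h1]; norm_num
      · rw [H.hq0, hd, hb, h1, h2, ← hq]; norm_num
      · rw [H.hq1, hd, ha, h1, h2, sub_self (1:ℝ), hJz]; norm_num

/-- length of phase `i` -/
def len (L i : ℕ) : ℕ := 2 ^ (i / L + 1)

/-- start of phase `i` -/
def start (L i : ℕ) : ℕ := ∑ k ∈ Finset.range i, len L k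

lemma start_succ (L i : ℕ) : start L (i+1) = start L i + len L i := Finset.sum_range_succ _ _

lemma len_pos (L i : ℕ) : 2 ≤ len L i := by
  unfold len
  rw [pow_succ]
  have := Nat.one_le_two_pow (n := i / L)
  omega

lemma div_mod_succ (L i : ℕ) (hL : 1 ≤ L) :
    (i % L + 1 = L ∧ (i+1) % L = 0 ∧ (i+1)/L = i/L + 1) ∨
    (i % L + 1 < L ∧ (i+1) % L = i % L + 1 ∧ (i+1)/L = i/L) := by
  have h := Nat.mod_lt i hL
  have hi := Nat.div_add_mod i L
  rcases Nat.lt_or_ge (i % L + 1) L with h1 | h1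
  · right
    have e : i + 1 = (i % L + 1) + L * (i / L) := by omega
    refine ⟨h1, ?_, ?_⟩
    · rw [e, Nat.add_mul_mod_self_left, Nat.mod_eq_of_lt h1]
    · conv_lhs => rw [e]
      rw [Nat.add_mul_div_left _ _ hL, Nat.div_eq_of_lt h1, zero_add]
  · left
    have h2 : i % L + 1 = L := by omega
    have e : i + 1 = L * (i / L + 1) := by rw [mul_add, mul_one]; omega
    refine ⟨h2, ?_, ?_⟩
    · rw [e]; simp
    · conv_lhs => rw [e]
      rw [Nat.mul_div_cancel_left _ hL]

lemma clk_start {L : ℕ} (hL : 1 ≤ L) {q0 q1 d p j : ℕ → ℝ} (H : Clk L q0 q1 d p j)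
    (h0 : PS q0 q1 d p j 0 1 0) (i : ℕ) :
    PS q0 q1 d p j (start L i) (len L i - 1) (i % L) := by
  induction i with
  | zero => simpa [start, len] using h0
  | succ i ih =>
    have hl := len_pos L i
    have := clk_next H ih (by omega) (Nat.mod_lt i hL)
    rw [start_succ]
    have e : start L i + (len L i - 1) + 1 = start L i + len L i := by omega
    rw [e] at this
    rcases div_mod_succ L i hL with ⟨h1, h2, h3⟩ | ⟨h1, h2, h3⟩
    · rw [if_pos h1, if_pos h1] at this
      have e2 : len L (i+1) = 2 * len L i := by
        simp only [len, h3]; ring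
      rw [h2, e2]
      convert this using 1
      omega
    · rw [if_neg (by omega), if_neg (by omega)] at this
      have e2 : len L (i+1) = len L i := by
        simp only [len, h3]
      rw [h2, e2]
      exact this

lemma clk_pulse {L : ℕ} (hL : 1 ≤ L) {q0 q1 d p j : ℕ → ℝ} (H : Clk L q0 q1 d p j)
    (h0 : PS q0 q1 d p j 0 1 0) (i s : ℕ) (hs : s < len L i) :
    p (start L i + s) = if s + 1 = len L i then 1 else 0 := by
  have hl := len_pos L i
  have := (clk_mid H (clk_start hL H h0 i) (by omega) (Nat.mod_lt i hL) s (by omega)).1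
  rw [this]
  have : s = len L i - 1 ↔ s + 1 = len L i := by omega
  simp only [this]

lemma start_eq (L : ℕ) (hL : 1 ≤ L) (i : ℕ) :
    start L i + 2 * L = L * 2 ^ (i / L + 1) + (i % L) * 2 ^ (i / L + 1) := by
  induction i with
  | zero => simp [start]; ring
  | succ i ih =>
    rw [start_succ, len]
    rcases div_mod_succ L i hL with ⟨h1, h2, h3⟩ | ⟨h1, h2, h3⟩
    · rw [h2, h3]
      have : start L i + 2 ^ (i / L + 1) + 2 * L = L * 2 ^ (i / L + 1) + (i % L + 1) * 2 ^ (i / L + 1) := by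
        linarith
      rw [this, h1]; ring
    · rw [h2, h3]
      linarith

lemma start_bound (L : ℕ) (hL : 1 ≤ L) (i : ℕ) : start L (i+1) ≤ 4 * L * 2 ^ (i / L) := by
  have h := start_eq L hL i
  rw [start_succ, len]
  have h1 : i % L + 1 ≤ L := Nat.mod_lt i hL
  have : (i % L + 1) * 2 ^ (i / L + 1) ≤ L * 2 ^ (i / L + 1) := Nat.mul_le_mul_right _ h1
  have e : 4 * L * 2 ^ (i / L) = L * 2 ^ (i / L + 1) + L * 2 ^ (i / L + 1) := by ring
  rw [e]
  linarith

lemma exists_phase (L : ℕ) (t : ℕ) : ∃ i s, s < len L i ∧ t = start L i + s := by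
  induction t with
  | zero => exact ⟨0, 0, by have := len_pos L 0; omega, by simp [start]⟩
  | succ t ih =>
    obtain ⟨i, s, hs, rfl⟩ := ih
    by_cases h : s + 1 < len L i
    · exact ⟨i, s+1, h, by ring⟩
    · refine ⟨i+1, 0, by have := len_pos L (i+1); omega, ?_⟩
      rw [start_succ]; omega

lemma len_mono (L : ℕ) {i i' : ℕ} (h : i ≤ i') : len L i ≤ len L i' := by
  unfold len
  exact Nat.pow_le_pow_right (by norm_num) (by have := Nat.div_le_div_right (c := L) h; omega)

/-! ## The squaring and multiplication modules -/

/-- scaled iterated tent map -/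
noncomputable def tw (u : ℝ) : ℕ → ℝ
  | 0 => u
  | s + 1 => tw u s / 2 - max 0 (tw u s - (1/4)^s / 2)

/-- approximate square -/
noncomputable def ta (u : ℝ) : ℕ → ℝ
  | 0 => u
  | s + 1 => ta u s - tw u (s+1)

lemma tw_bd {u : ℝ} (h0 : 0 ≤ u) (h1 : u ≤ 1) (s : ℕ) : 0 ≤ tw u s ∧ tw u s ≤ (1/4)^s := by
  induction s with
  | zero => simpa [tw] using ⟨h0, h1⟩
  | succ s ih =>
    obtain ⟨a, b⟩ := ih
    rw [tw, pow_succ]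
    rcases le_total (tw u s) ((1/4)^s/2) with h | h
    · rw [max_eq_left (by linarith)]
      constructor <;> linarith
    · rw [max_eq_right (by linarith)]
      constructor <;> linarith

lemma ta_eq (u : ℝ) (s : ℕ) : ta u s - u^2 = tw u s - 4^s * (tw u s)^2 := by
  induction s with
  | zero => simp [ta, tw]
  | succ s ih =>
    rw [ta]
    have h4 : (4:ℝ)^s * (1/4)^s = 1 := by rw [← mul_pow]; norm_num
    have key : tw u s - 4^s * (tw u s)^2 - tw u (s+1) = tw u (s+1) - 4^(s+1) * (tw u (s+1))^2 := by
      rw [tw, pow_succ (4:ℝ)]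
      rcases le_total (tw u s) ((1/4)^s/2) with h | h
      · rw [max_eq_left (by linarith)]
        ring
      · rw [max_eq_right (by linarith)]
        generalize tw u s = w at *
        generalize (4:ℝ)^s = A at *
        generalize (1/4:ℝ)^s = B at *
        linear_combination (B - 2 * w) * h4
    linarith

lemma ta_bd {u : ℝ} (h0 : 0 ≤ u) (h1 : u ≤ 1) (s : ℕ) :
    u^2 ≤ ta u s ∧ ta u s ≤ u^2 + (1/4)^(s+1) ∧ ta u s ≤ u := by
  obtain ⟨a, b⟩ := tw_bd h0 h1 s
  have e := ta_eq u s
  have h4 : (4:ℝ)^s * (1/4)^s = 1 := by rw [← mul_pow]; norm_num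
  have hA : (0:ℝ) < 4^s := by positivity
  have hB : (0:ℝ) < (1/4)^s := by positivity
  refine ⟨?_, ?_, ?_⟩
  · have : 4^s * (tw u s)^2 ≤ tw u s := by
      calc (4:ℝ)^s * (tw u s)^2 = (4^s * tw u s) * tw u s := by ring
        _ ≤ (4^s * (1/4)^s) * tw u s := by gcongr
        _ = tw u s := by rw [h4, one_mul]
    linarith
  · have : 0 ≤ 4^s * (tw u s - (1/4)^s/2)^2 := by positivity
    rw [pow_succ (1/4:ℝ)]
    generalize tw u s = w at *
    generalize (4:ℝ)^s = A at *
    generalize (1/4:ℝ)^s = B at *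
    have : A * (w - B/2)^2 = A * w^2 - w + B / 4 := by
      linear_combination (-w + B/4) * h4
    linarith
  · clear a b e h4 hA hB
    induction s with
    | zero => simp [ta]
    | succ s ih =>
      rw [ta]
      have := (tw_bd h0 h1 (s+1)).1
      linarith

lemma gate_abs0 {e : ℝ} (he : |e| ≤ 2) : max 0 (e - 2 * (1 - 0)) = 0 ∧ max 0 (-e - 2 * (1 - 0)) = 0 := by
  obtain ⟨a, b⟩ := abs_le.mp he
  constructor <;> rw [max_eq_left] <;> linarith

lemma gate_abs1 (e : ℝ) : max 0 (e - 2 * (1 - 1)) + max 0 (-e - 2 * (1 - 1)) = |e| := by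
  rcases le_total 0 e with h | h
  · rw [abs_of_nonneg h, max_eq_right (by linarith), max_eq_left (by linarith)]; ring
  · rw [abs_of_nonpos h, max_eq_left (by linarith), max_eq_right (by linarith)]; ring

lemma relu_diff (a : ℝ) : max 0 a - max 0 (-a) = a := by
  rcases le_total 0 a with h | h
  · rw [max_eq_right h, max_eq_left (by linarith)]; ring
  · rw [max_eq_left h, max_eq_right (by linarith)]; ring

/-- One multiplication module, driven by the pulse `p`, the scale `c`, and the two inputs. -/
structure MulM (p c w v y a b : ℕ → ℝ) : Prop where
  hw : ∀ t, w (t+1) = 0 + (1/2) * max 0 (w t - 2 * p t) + (-1) * max 0 (w t - 1/2 * c t - 2 * p t)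
    + 1 * max 0 (1/2 * (a t + b t) - 2 * (1 - p t)) + 1 * max 0 (-(1/2 * (a t + b t)) - 2 * (1 - p t))
  hv : ∀ t, v (t+1) = 0 + (1/2) * max 0 (v t - 2 * p t) + (-1) * max 0 (v t - 1/2 * c t - 2 * p t)
    + 1 * max 0 (1/2 * (a t - b t) - 2 * (1 - p t)) + 1 * max 0 (-(1/2 * (a t - b t)) - 2 * (1 - p t))
  hy : ∀ t, y (t+1) = 0 + 1 * max 0 (y t - 2 * p t) + (-1) * max 0 (- y t - 2 * p t)
    + (-1/2) * max 0 (w t - 2 * p t) + 1 * max 0 (w t - 1/2 * c t - 2 * p t)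
    + (1/2) * max 0 (v t - 2 * p t) + (-1) * max 0 (v t - 1/2 * c t - 2 * p t)
    + 1 * max 0 (1/2 * (a t + b t) - 2 * (1 - p t)) + 1 * max 0 (-(1/2 * (a t + b t)) - 2 * (1 - p t))
    + (-1) * max 0 (1/2 * (a t - b t) - 2 * (1 - p t)) + (-1) * max 0 (-(1/2 * (a t - b t)) - 2 * (1 - p t))

lemma half_sum_le {a b : ℝ} (ha : |a| ≤ 1) (hb : |b| ≤ 1) :
    |1/2 * (a + b)| ≤ 1 ∧ |1/2 * (a - b)| ≤ 1 := by
  rw [abs_le] at *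
  rw [abs_le]
  constructor <;> constructor <;> linarith

lemma MulM.run {p c w v y a b : ℕ → ℝ} (H : MulM p c w v y a b) {T s : ℕ} {u u' : ℝ}
    (hu : 0 ≤ u ∧ u ≤ 1) (hu' : 0 ≤ u' ∧ u' ≤ 1)
    (hp : p (T+s) = 0) (hc : c (T+s) = (1/4)^s) (ha : |a (T+s)| ≤ 1) (hb : |b (T+s)| ≤ 1)
    (hw : w (T+s) = tw u s) (hv : v (T+s) = tw u' s) (hy : y (T+s) = ta u s - ta u' s) :
    w (T+s+1) = tw u (s+1) ∧ v (T+s+1) = tw u' (s+1) ∧ y (T+s+1) = ta u (s+1) - ta u' (s+1) := by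
  obtain ⟨h1, h2⟩ := half_sum_le ha hb
  obtain ⟨e1, e2⟩ := gate_abs0 (h1.trans one_le_two)
  obtain ⟨e3, e4⟩ := gate_abs0 (h2.trans one_le_two)
  have f1 := max_eq_right (tw_bd hu.1 hu.2 s).1
  have f2 := max_eq_right (tw_bd hu'.1 hu'.2 s).1
  have f3 := relu_diff (ta u s - ta u' s)
  have g : (1/2 : ℝ) * (1/4)^s = (1/4)^s/2 := by ring
  refine ⟨?_, ?_, ?_⟩
  · rw [H.hw, hp, hc, hw, e1, e2, mul_zero, sub_zero, sub_zero, f1, tw, g]; ring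
  · rw [H.hv, hp, hc, hv, e3, e4, mul_zero, sub_zero, sub_zero, f2, tw, g]; ring
  · rw [H.hy, hp, hc, hw, hv, hy, e1, e2, e3, e4, ta, ta, tw, tw, g]
    simp only [mul_zero, sub_zero, f1, f2]
    linear_combination f3

lemma MulM.load {p c w v y a b : ℕ → ℝ} (H : MulM p c w v y a b) {t : ℕ}
    (hp : p t = 1) (hc : 0 ≤ c t) (hw : w t ≤ 1) (hv : v t ≤ 1) (hy : |y t| ≤ 1) :
    w (t+1) = |1/2 * (a t + b t)| ∧ v (t+1) = |1/2 * (a t - b t)| ∧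
      y (t+1) = |1/2 * (a t + b t)| - |1/2 * (a t - b t)| := by
  obtain ⟨h1, h2⟩ := abs_le.mp hy
  have e1 : max 0 (w t - 2 * 1) = 0 := max_eq_left (by linarith)
  have e2 : max 0 (w t - 1/2 * c t - 2 * 1) = 0 := max_eq_left (by linarith)
  have e3 : max 0 (v t - 2 * 1) = 0 := max_eq_left (by linarith)
  have e4 : max 0 (v t - 1/2 * c t - 2 * 1) = 0 := max_eq_left (by linarith)
  have e5 : max 0 (y t - 2 * 1) = 0 := max_eq_left (by linarith)
  have e6 : max 0 (- y t - 2 * 1) = 0 := max_eq_left (by linarith)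
  have g1 := gate_abs1 (1/2 * (a t + b t))
  have g2 := gate_abs1 (1/2 * (a t - b t))
  refine ⟨?_, ?_, ?_⟩
  · rw [H.hw, hp, e1, e2]; linarith
  · rw [H.hv, hp, e3, e4]; linarith
  · rw [H.hy, hp, e1, e2, e3, e4, e5, e6]; linarith

lemma ta_prod {a b : ℝ} (ha : |a| ≤ 1) (hb : |b| ≤ 1) (s : ℕ) :
    |ta |1/2 * (a + b)| s - ta |1/2 * (a - b)| s - a * b| ≤ (1/4)^(s+1) := by
  obtain ⟨h1, h2⟩ := half_sum_le ha hb
  obtain ⟨u1, u2, -⟩ := ta_bd (abs_nonneg _) h1 s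
  obtain ⟨v1, v2, -⟩ := ta_bd (abs_nonneg _) h2 s
  rw [sq_abs] at *
  rw [abs_le]
  constructor <;> nlinarith

lemma ta_diff_le {u u' : ℝ} (hu : 0 ≤ u ∧ u ≤ 1) (hu' : 0 ≤ u' ∧ u' ≤ 1) (s : ℕ) :
    |ta u s - ta u' s| ≤ 1 := by
  obtain ⟨u1, -, u2⟩ := ta_bd hu.1 hu.2 s
  obtain ⟨v1, -, v2⟩ := ta_bd hu'.1 hu'.2 s
  rw [abs_le]
  constructor <;> nlinarith [sq_nonneg u', sq_nonneg u]

/-! ## Assembling the modules -/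

def lo {N : ℕ} (k : Fin (N+1)) : Fin (N+1) := ⟨k.1 / 2, by have := k.2; omega⟩
def hi {N : ℕ} (k : Fin (N+1)) : Fin (N+1) := ⟨k.1 - k.1 / 2, by have := k.2; omega⟩

structure Sys (L N : ℕ) (z : ℝ) (p c : ℕ → ℝ) (w v y V : Fin (N+1) → ℕ → ℝ) : Prop where
  hz : |z| ≤ 1
  hp : ∀ i s, s < len L i → p (start L i + s) = if s + 1 = len L i then 1 else 0
  hc0 : c 0 = 1
  hc : ∀ t, c (t+1) = 0 + (1/4) * max 0 (c t - 2 * p t) + 1 * max 0 (p t)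
  hm : ∀ k, MulM p c (w k) (v k) (y k) (V (lo k)) (V (hi k))
  hw0 : ∀ k, w k 0 = 0
  hv0 : ∀ k, v k 0 = 0
  hy0 : ∀ k, y k 0 = 0
  hV : ∀ k t, V k t = if k.1 = 0 then 1 else if k.1 = 1 then z else y k t

section
variable {L N : ℕ} {z : ℝ} {p c : ℕ → ℝ} {w v y V : Fin (N+1) → ℕ → ℝ}

lemma Sys.V_le (H : Sys L N z p c w v y V) {t : ℕ} (h : ∀ k, |y k t| ≤ 1) (k : Fin (N+1)) :
    |V k t| ≤ 1 := by
  rw [H.hV]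
  split_ifs
  · simp
  · exact H.hz
  · exact h k

lemma Sys.c_eq (H : Sys L N z p c w v y V) (i : ℕ) :
    ∀ s, s < len L i → c (start L i + s) = (1/4)^s := by
  have run : ∀ i, c (start L i) = 1 → ∀ s, s < len L i → c (start L i + s) = (1/4)^s := by
    intro i h0 s
    induction s with
    | zero => intro _; simpa using h0
    | succ s ih =>
      intro hs
      have hp := H.hp i s (by omega)
      rw [if_neg (by omega)] at hp
      have hpos : (0:ℝ) ≤ (1/4)^s := by positivity
      rw [← add_assoc, H.hc, hp, ih (by omega), mul_zero, sub_zero, max_eq_right hpos, pow_succ]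
      simp; ring
  apply run
  induction i with
  | zero => simpa [start] using H.hc0
  | succ i ih =>
    have hl := len_pos L i
    have h := run i ih (len L i - 1) (by omega)
    have hp := H.hp i (len L i - 1) (by omega)
    rw [if_pos (by omega)] at hp
    have e : start L (i+1) = start L i + (len L i - 1) + 1 := by rw [start_succ]; omega
    have h1 : ((1:ℝ)/4)^(len L i - 1) ≤ 1 := pow_le_one₀ (by norm_num) (by norm_num)
    rw [e, H.hc, hp, h, max_eq_left (by linarith)]
    norm_num

def Good (L N : ℕ) (w v y : Fin (N+1) → ℕ → ℝ) (i : ℕ) (u u' : Fin (N+1) → ℝ) : Prop :=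
  (∀ k, (0 ≤ u k ∧ u k ≤ 1) ∧ (0 ≤ u' k ∧ u' k ≤ 1)) ∧ ∀ s, s < len L i → ∀ k,
    w k (start L i + s) = tw (u k) s ∧ v k (start L i + s) = tw (u' k) s ∧
      y k (start L i + s) = ta (u k) s - ta (u' k) s

lemma Good.y_le {i : ℕ} {u u' : Fin (N+1) → ℝ} (G : Good L N w v y i u u') {s : ℕ}
    (hs : s < len L i) (k : Fin (N+1)) : |y k (start L i + s)| ≤ 1 := by
  rw [(G.2 s hs k).2.2]
  exact ta_diff_le (G.1 k).1 (G.1 k).2 s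

lemma Sys.good_run (H : Sys L N z p c w v y V) (i : ℕ) (u u' : Fin (N+1) → ℝ)
    (hu : ∀ k, (0 ≤ u k ∧ u k ≤ 1) ∧ (0 ≤ u' k ∧ u' k ≤ 1))
    (h0 : ∀ k, w k (start L i) = u k ∧ v k (start L i) = u' k ∧ y k (start L i) = u k - u' k) :
    Good L N w v y i u u' := by
  refine ⟨hu, fun s => ?_⟩
  induction s with
  | zero => intro _ k; simpa [tw, ta] using h0 k
  | succ s ih =>
    intro hs k
    have ih := ih (by omega)
    have hp := H.hp i s (by omega)
    rw [if_neg (by omega)] at hp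
    have hV := H.V_le (t := start L i + s) (fun k => by
      rw [(ih k).2.2]
      exact ta_diff_le (hu k).1 (hu k).2 s)
    exact (H.hm k).run (hu k).1 (hu k).2 hp (H.c_eq i s (by omega)) (hV _) (hV _)
      (ih k).1 (ih k).2.1 (ih k).2.2

/-- last time of phase `i` -/
def last (L i : ℕ) : ℕ := start L i + (len L i - 1)

lemma last_succ (L i : ℕ) : last L i + 1 = start L (i+1) := by
  have := len_pos L i
  rw [start_succ, last]; omega

lemma Sys.p_last (H : Sys L N z p c w v y V) (i : ℕ) : p (last L i) = 1 := by
  have := len_pos L i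
  rw [last, H.hp i _ (by omega), if_pos (by omega)]

lemma Sys.good_next (H : Sys L N z p c w v y V) (i : ℕ) (u u' : Fin (N+1) → ℝ)
    (G : Good L N w v y i u u') :
    Good L N w v y (i+1)
      (fun k => |1/2 * (V (lo k) (last L i) + V (hi k) (last L i))|)
      (fun k => |1/2 * (V (lo k) (last L i) - V (hi k) (last L i))|) := by
  have hl := len_pos L i
  have hs : len L i - 1 < len L i := by omega
  have hV := H.V_le (t := last L i) (fun k => G.y_le hs k)
  apply H.good_run
  · intro k
    obtain ⟨a, b⟩ := half_sum_le (hV (lo k)) (hV (hi k))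
    exact ⟨⟨abs_nonneg _, a⟩, ⟨abs_nonneg _, b⟩⟩
  · intro k
    rw [← last_succ]
    obtain ⟨g1, g2, g3⟩ := G.2 _ hs k
    have h1 : ((1:ℝ)/4)^(len L i - 1) ≤ 1 := pow_le_one₀ (by norm_num) (by norm_num)
    apply (H.hm k).load (H.p_last i)
    · rw [last, H.c_eq i _ hs]; positivity
    · rw [last, g1]; exact (tw_bd (G.1 k).1.1 (G.1 k).1.2 _).2.trans h1
    · rw [last, g2]; exact (tw_bd (G.1 k).2.1 (G.1 k).2.2 _).2.trans h1
    · exact G.y_le hs k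

lemma Sys.good_ex (H : Sys L N z p c w v y V) (i : ℕ) : ∃ u u', Good L N w v y i u u' := by
  induction i with
  | zero =>
    refine ⟨fun _ => 0, fun _ => 0, H.good_run 0 _ _ (by simp) ?_⟩
    intro k
    simp [start, H.hw0, H.hv0, H.hy0]
  | succ i ih =>
    obtain ⟨u, u', G⟩ := ih
    exact ⟨_, _, H.good_next i u u' G⟩

lemma Sys.V_bd (H : Sys L N z p c w v y V) (t : ℕ) (k : Fin (N+1)) : |V k t| ≤ 1 := by
  obtain ⟨i, s, hs, rfl⟩ := exists_phase L t
  obtain ⟨u, u', G⟩ := H.good_ex i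
  exact H.V_le (fun k => G.y_le hs k) k

lemma Sys.V_prod (H : Sys L N z p c w v y V) (i : ℕ) (k : Fin (N+1)) (hk : 2 ≤ k.1) :
    |V k (last L (i+1)) - V (lo k) (last L i) * V (hi k) (last L i)| ≤ (1/4)^(len L (i+1)) := by
  obtain ⟨u, u', G⟩ := H.good_ex i
  have hl := len_pos L (i+1)
  have := ((H.good_next i u u' G).2 (len L (i+1) - 1) (by omega) k).2.2
  rw [H.hV k, if_neg (by omega), if_neg (by omega), last, this]
  have h := ta_prod (H.V_bd (last L i) (lo k)) (H.V_bd (last L i) (hi k)) (len L (i+1) - 1)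
  have e : len L (i+1) - 1 + 1 = len L (i+1) := by omega
  rw [e] at h
  exact h

lemma Sys.V_pow (H : Sys L N z p c w v y V) (r : ℕ) : ∀ (i : ℕ) (k : Fin (N+1)), r ≤ i → 1 ≤ k.1 →
    k.1 ≤ 2^r → |V k (last L i) - z^k.1| ≤ ((k.1:ℝ) - 1) * (1/4)^(len L (i+1-r)) := by
  induction r with
  | zero =>
    intro i k _ h1 h2
    have : k.1 = 1 := by simp at h2; omega
    rw [H.hV, if_neg (by omega), if_pos this, this]
    simp
  | succ r ih =>
    intro i k hi h1 h2
    rcases Nat.lt_or_ge k.1 2 with h | h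
    · have : k.1 = 1 := by omega
      rw [H.hV, if_neg (by omega), if_pos this, this]
      simp
    · obtain ⟨i, rfl⟩ : ∃ i', i = i' + 1 := ⟨i - 1, by omega⟩
      rw [pow_succ] at h2
      have a1 := ih i (lo k) (by omega) (by simp [lo]; omega) (by simp [lo]; omega)
      have a2 := ih i (_root_.hi k) (by omega) (by simp [_root_.hi]; omega) (by simp [_root_.hi]; omega)
      have a3 := H.V_prod i k h
      have e : i + 1 + 1 - (r + 1) = i + 1 - r := by omega
      rw [e]
      have a4 : ((1:ℝ)/4)^(len L (i+1)) ≤ (1/4)^(len L (i+1-r)) :=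
        pow_le_pow_of_le_one (by norm_num) (by norm_num) (len_mono L (by omega))
      have hk : (lo k).1 + (_root_.hi k).1 = k.1 := by simp [lo, _root_.hi]; omega
      have hkR : ((lo k).1 : ℝ) + ((_root_.hi k).1 : ℝ) = k.1 := by exact_mod_cast hk
      have b1 := H.V_bd (last L i) (lo k)
      have b2 : |z^(_root_.hi k).1| ≤ 1 := by
        rw [abs_pow]; exact pow_le_one₀ (abs_nonneg _) H.hz
      rw [← hk, pow_add, hk, ← hkR]
      set A := V (lo k) (last L i)
      set B := V (_root_.hi k) (last L i)
      set P := z^(lo k).1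
      set Q := z^(_root_.hi k).1
      set δ := ((1:ℝ)/4)^(len L (i+1-r))
      have : V k (last L (i+1)) - P * Q
          = (V k (last L (i+1)) - A * B) + A * (B - Q) + (A - P) * Q := by ring
      rw [this]
      have t1 : |A * (B - Q)| ≤ |B - Q| := by
        rw [abs_mul]; exact mul_le_of_le_one_left (abs_nonneg _) b1
      have t2 : |(A - P) * Q| ≤ |A - P| := by
        rw [abs_mul]; exact mul_le_of_le_one_right (abs_nonneg _) b2
      have := abs_add_three (V k (last L (i+1)) - A * B) (A * (B - Q)) ((A - P) * Q)
      nlinarith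

/-- the hold register -/
lemma Sys.hold (H : Sys L N z p c w v y V) (b : Fin (N+1) → ℝ) (B : ℝ) (hB : ∑ k, |b k| ≤ B)
    (P : ℕ → ℝ) (hP0 : P 0 = 0)
    (hP : ∀ t, P (t+1) = 0 + 1 * max 0 (P t - B * p t) + (-1) * max 0 (- P t - B * p t)
      + 1 * max 0 ((∑ k, b k * V k t) - B * (1 - p t))
      + (-1) * max 0 (- (∑ k, b k * V k t) - B * (1 - p t))) (i s : ℕ) (hs : s < len L i) :
    P (start L i + s) = if i = 0 then 0 else ∑ k, b k * V k (last L (i-1)) := by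
  have hS : ∀ t, |∑ k, b k * V k t| ≤ B := by
    intro t
    refine (Finset.abs_sum_le_sum_abs _ _).trans (le_trans ?_ hB)
    refine Finset.sum_le_sum fun k _ => ?_
    rw [abs_mul]
    exact mul_le_of_le_one_right (abs_nonneg _) (H.V_bd t k)
  have run : ∀ i, ∀ s, s < len L i → P (start L i + s) = P (start L i) := by
    intro i s
    induction s with
    | zero => intro _; simp
    | succ s ih =>
      intro hs
      have hp := H.hp i s (by omega)
      rw [if_neg (by omega)] at hp
      obtain ⟨s1, s2⟩ := abs_le.mp (hS (start L i + s))
      rw [← add_assoc, hP, hp, max_eq_left (b := (∑ k, b k * V k _) - _) (by linarith),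
        max_eq_left (b := -(∑ k, b k * V k _) - _) (by linarith), mul_zero, sub_zero, sub_zero,
        ← ih (by omega)]
      linarith [relu_diff (P (start L i + s))]
  rw [run i s hs]
  clear hs
  induction i with
  | zero => simpa [start] using hP0
  | succ i ih =>
    have hl := len_pos L i
    have hlast : P (last L i) = P (start L i) := run i _ (by omega)
    have hb : |P (last L i)| ≤ B := by
      rw [hlast, ih]
      split_ifs
      · simpa using (abs_nonneg _).trans (hS 0)
      · exact hS _
    obtain ⟨s1, s2⟩ := abs_le.mp hb
    rw [← last_succ, hP, H.p_last, max_eq_left (b := P _ - _) (by linarith),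
      max_eq_left (b := - P _ - _) (by linarith), if_neg (by omega), Nat.add_sub_cancel, sub_self]
    simp only [mul_zero, sub_zero]
    linarith [relu_diff (∑ k, b k * V k (last L i))]

end

/-! ## The concrete system -/

abbrev St (N : ℕ) : Type := Fin 8 ⊕ (Fin (N+1) × Fin 3)

noncomputable def vl {N : ℕ} (y : St N → ℝ) (k : Fin (N+1)) : ℝ :=
  if k.1 = 0 then 1 else if k.1 = 1 then y (Sum.inl 6) else y (Sum.inr (k, 2))

noncomputable def stepG (L N : ℕ) (b : Fin (N+1) → ℝ) (B : ℝ) (y : St N → ℝ) : Fin 8 → ℝ :=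
  ![0 + 1 * max 0 (y (Sum.inl 0)) + (-1) * max 0 (1 - y (Sum.inl 2) - y (Sum.inl 3))
      + 1 * max 0 (y (Sum.inl 2) - y (Sum.inl 3))
      + 1 * max 0 (y (Sum.inl 2) + y (Sum.inl 4) - (L - 1)),
    0 + 1 * max 0 (y (Sum.inl 1)) + (-1) * max 0 (y (Sum.inl 2) - y (Sum.inl 3))
      + 1 * max 0 (1 - y (Sum.inl 2) - y (Sum.inl 3))
      + 1 * max 0 (1 - y (Sum.inl 2) + y (Sum.inl 4) - (L - 1)),
    0 + 1 * max 0 (y (Sum.inl 2) - y (Sum.inl 3)) + 1 * max 0 (y (Sum.inl 3) - y (Sum.inl 2)),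
    0 + 1 * max 0 (2 - y (Sum.inl 0) - 2 * y (Sum.inl 2))
      + (-2) * max 0 (1 - y (Sum.inl 0) - 2 * y (Sum.inl 2))
      + 1 * max 0 (2 * y (Sum.inl 2) - y (Sum.inl 1))
      + (-2) * max 0 (2 * y (Sum.inl 2) - 1 - y (Sum.inl 1)),
    0 + 1 * max 0 (y (Sum.inl 4)) + 1 * max 0 (y (Sum.inl 3))
      + (-(L:ℝ)) * max 0 (y (Sum.inl 4) + y (Sum.inl 3) - (L - 1)),
    0 + (1/4) * max 0 (y (Sum.inl 5) - 2 * y (Sum.inl 3)) + 1 * max 0 (y (Sum.inl 3)),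
    0 + 1 * max 0 (y (Sum.inl 6)) + (-1) * max 0 (- y (Sum.inl 6)),
    0 + 1 * max 0 (y (Sum.inl 7) - B * y (Sum.inl 3))
      + (-1) * max 0 (- y (Sum.inl 7) - B * y (Sum.inl 3))
      + 1 * max 0 ((∑ k, b k * vl y k) - B * (1 - y (Sum.inl 3)))
      + (-1) * max 0 (- (∑ k, b k * vl y k) - B * (1 - y (Sum.inl 3)))]

noncomputable def stepM (p c w v y a b : ℝ) : Fin 3 → ℝ :=
  ![0 + (1/2) * max 0 (w - 2 * p) + (-1) * max 0 (w - 1/2 * c - 2 * p)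
      + 1 * max 0 (1/2 * (a + b) - 2 * (1 - p)) + 1 * max 0 (-(1/2 * (a + b)) - 2 * (1 - p)),
    0 + (1/2) * max 0 (v - 2 * p) + (-1) * max 0 (v - 1/2 * c - 2 * p)
      + 1 * max 0 (1/2 * (a - b) - 2 * (1 - p)) + 1 * max 0 (-(1/2 * (a - b)) - 2 * (1 - p)),
    0 + 1 * max 0 (y - 2 * p) + (-1) * max 0 (- y - 2 * p)
      + (-1/2) * max 0 (w - 2 * p) + 1 * max 0 (w - 1/2 * c - 2 * p)
      + (1/2) * max 0 (v - 2 * p) + (-1) * max 0 (v - 1/2 * c - 2 * p)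
      + 1 * max 0 (1/2 * (a + b) - 2 * (1 - p)) + 1 * max 0 (-(1/2 * (a + b)) - 2 * (1 - p))
      + (-1) * max 0 (1/2 * (a - b) - 2 * (1 - p)) + (-1) * max 0 (-(1/2 * (a - b)) - 2 * (1 - p))]

noncomputable def stepF (L N : ℕ) (b : Fin (N+1) → ℝ) (B : ℝ) (y : St N → ℝ) : St N → ℝ :=
  Sum.elim (stepG L N b B y) (fun q => stepM (y (Sum.inl 3)) (y (Sum.inl 5)) (y (Sum.inr (q.1, 0)))
    (y (Sum.inr (q.1, 1))) (y (Sum.inr (q.1, 2))) (vl y (lo q.1)) (vl y (hi q.1)) q.2)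

lemma aff_vl {N : ℕ} (k : Fin (N+1)) : Aff (fun y : St N → ℝ => vl y k) := by
  unfold vl
  split_ifs
  · exact Aff.const 1
  · exact Aff.coord _
  · exact Aff.coord _

lemma aff_comb {N : ℕ} (b : Fin (N+1) → ℝ) : Aff (fun y : St N → ℝ => ∑ k, b k * vl y k) :=
  Aff.sum _ _ fun k => (aff_vl k).smul (b k)

lemma stepF_lay (L N : ℕ) (b : Fin (N+1) → ℝ) (B : ℝ) (s : St N) :
    IsLay 10 (fun y => stepF L N b B y s) := by
  rcases s with i | ⟨k, i⟩
  · fin_cases i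
    all_goals
      simp only [stepF, stepG, Sum.elim_inl]
      repeat' first
        | exact IsLay.const _ _
        | exact aff_comb b
        | exact Aff.const _
        | exact Aff.coord _
        | apply IsLay.cons
        | apply Aff.sub
        | apply Aff.add
        | apply Aff.neg
        | apply Aff.smul
  · fin_cases i
    all_goals
      simp only [stepF, stepM, Sum.elim_inr]
      repeat' first
        | exact IsLay.const _ _
        | exact aff_vl _
        | exact Aff.const _
        | exact Aff.coord _
        | apply IsLay.cons
        | apply Aff.sub
        | apply Aff.add
        | apply Aff.neg
        | apply Aff.smul

lemma rate {L t m : ℕ} (hL : 1 ≤ L) (h : t ≤ 4 * L * m) :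
    ((1:ℝ)/4)^m ≤ (4:ℝ) ^ (-(1 / (4 * (L : ℝ))) * (t : ℝ)) := by
  have e : ((1:ℝ)/4)^m = (4:ℝ) ^ (-(m:ℝ)) := by
    rw [Real.rpow_neg (by norm_num), Real.rpow_natCast, one_div, inv_pow]
  rw [e]
  apply Real.rpow_le_rpow_of_exponent_le (by norm_num)
  have hL' : (0:ℝ) < 4 * L := by positivity
  have h' : (t:ℝ) ≤ 4 * L * m := by exact_mod_cast h
  rw [neg_mul, neg_le_neg_iff, one_div, inv_mul_le_iff₀ hL']
  exact h'

lemma main_case (L N : ℕ) (hL : 1 ≤ L) (hN : 2 ≤ N) (hNL : N ≤ 2^L) (D : ℝ) (hD : 1 ≤ D)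
    (a : Fin (N + 1) → ℝ) :
    ∃ (mh : ℕ) (R : RNN (Fin 1) (Fin mh) (Fin 1)),
      mh ≤ 80 * N + 11 ∧
      ∀ x : ℝ, x ∈ Set.Icc (-D) D → ∀ t : ℕ,
        |R.out (fun _ => x) t 0 - ∑ i : Fin (N + 1), a i * x ^ (i : ℕ)| ≤
          (∑ i : Fin (N + 1), |a i|) * (16 * N * D ^ (2 * N)) *
            (4 : ℝ) ^ (-(1 / (4 * (L : ℝ))) * (t : ℝ)) := by
  have hD0 : 0 < D := by linarith
  let b : Fin (N+1) → ℝ := fun k => a k * D ^ k.1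
  let B : ℝ := ∑ k, |b k|
  let F := stepF L N b B
  obtain ⟨R, hR⟩ := realize F 10 (stepF_lay L N b B)
    (Sum.elim ![0, 0, 0, 0, 0, 0, D⁻¹, 0] (fun _ => 0))
    (Sum.elim ![1, 0, 0, 0, 0, 1, 0, 0] (fun _ => 0)) (Sum.inl 7)
  refine ⟨_, R, ?_, fun x hx t => ?_⟩
  · simp; omega
  rw [hR]
  set y0 : St N → ℝ := fun s => (Sum.elim ![0, 0, 0, 0, 0, 0, D⁻¹, 0] (fun _ => 0) : St N → ℝ) s * x +
    (Sum.elim ![1, 0, 0, 0, 0, 1, 0, 0] (fun _ => 0) : St N → ℝ) s with hy0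
  have hstep : ∀ t s, (F^[t+1] y0) s = stepF L N b B (F^[t] y0) s := by
    intro t s; rw [Function.iterate_succ_apply']
  have H : Clk L (fun t => (F^[t] y0) (Sum.inl 0)) (fun t => (F^[t] y0) (Sum.inl 1))
      (fun t => (F^[t] y0) (Sum.inl 2)) (fun t => (F^[t] y0) (Sum.inl 3))
      (fun t => (F^[t] y0) (Sum.inl 4)) :=
    ⟨fun t => hstep t _, fun t => hstep t _, fun t => hstep t _, fun t => hstep t _,
      fun t => hstep t _⟩
  have h0 : PS (fun t => (F^[t] y0) (Sum.inl 0)) (fun t => (F^[t] y0) (Sum.inl 1))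
      (fun t => (F^[t] y0) (Sum.inl 2)) (fun t => (F^[t] y0) (Sum.inl 3))
      (fun t => (F^[t] y0) (Sum.inl 4)) 0 1 0 := by
    simp [PS, hy0]
  let z : ℝ := D⁻¹ * x
  have hz : |z| ≤ 1 := by
    rw [abs_mul, abs_of_pos (inv_pos.mpr hD0), inv_mul_le_iff₀ hD0, mul_one]
    exact abs_le.mpr hx
  have hzt : ∀ t, (F^[t] y0) (Sum.inl 6) = z := by
    intro t
    induction t with
    | zero => simp [hy0, z]
    | succ t ih =>
      rw [hstep]
      change 0 + 1 * max 0 ((F^[t] y0) (Sum.inl 6)) + (-1) * max 0 (- (F^[t] y0) (Sum.inl 6)) = z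
      rw [ih]
      linarith [relu_diff z]
  have hS : Sys L N z (fun t => (F^[t] y0) (Sum.inl 3)) (fun t => (F^[t] y0) (Sum.inl 5))
      (fun k t => (F^[t] y0) (Sum.inr (k, 0))) (fun k t => (F^[t] y0) (Sum.inr (k, 1)))
      (fun k t => (F^[t] y0) (Sum.inr (k, 2))) (fun k t => vl (F^[t] y0) k) :=
    { hz := hz
      hp := clk_pulse hL H h0
      hc0 := by simp [hy0]
      hc := fun t => hstep t _
      hm := fun k => ⟨fun t => hstep t _, fun t => hstep t _, fun t => hstep t _⟩
      hw0 := by simp [hy0]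
      hv0 := by simp [hy0]
      hy0 := by simp [hy0]
      hV := by
        intro k t
        simp only [vl, hzt] }
  obtain ⟨i, s, hs, hts⟩ := exists_phase L (t+1)
  have hP := hS.hold b B le_rfl (fun t => (F^[t] y0) (Sum.inl 7)) (by simp [hy0])
    (fun t => hstep t _) i s hs
  rw [← hts] at hP
  rw [hP]
  have hVb := hS.V_bd
  have hVp := hS.V_pow
  have hV0 : ∀ t (k : Fin (N+1)), k.1 = 0 → vl (F^[t] y0) k = 1 := by
    intro t k hk; simp [vl, hk]
  obtain ⟨V, hV⟩ : ∃ V, V = (fun (k : Fin (N+1)) t => vl (F^[t] y0) k) := ⟨_, rfl⟩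
  have hV' : ∀ k t, vl (F^[t] y0) k = V k t := by
    intro k t; rw [hV]
  simp only [hV'] at hV0 hVb hVp ⊢
  have ht : t ≤ 4 * L * 2^(i/L) := by
    have := start_bound L hL i
    rw [start_succ] at this
    omega
  set A : ℝ := ∑ k, |a k| with hA
  have hA0 : 0 ≤ A := Finset.sum_nonneg fun _ _ => abs_nonneg _
  have hDN : D^N ≤ D^(2*N) := pow_le_pow_right₀ hD (by omega)
  have hDN0 : 0 < D^N := by positivity
  have hN' : (2:ℝ) ≤ N := by exact_mod_cast hN
  have hbb : ∀ k, |b k| ≤ |a k| * D^N := by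
    intro k
    rw [abs_mul, abs_of_pos (pow_pos hD0 _)]
    exact mul_le_mul_of_nonneg_left (pow_le_pow_right₀ hD (by have := k.2; omega)) (abs_nonneg _)
  have hpoly : ∑ k : Fin (N+1), a k * x ^ (k : ℕ) = ∑ k, b k * z ^ k.1 := by
    refine Finset.sum_congr rfl fun k _ => ?_
    simp only [b, z]
    rw [mul_pow, inv_pow]
    field_simp
  rw [hpoly]
  -- generic estimate
  have est : ∀ (U : Fin (N+1) → ℝ) (ε : ℝ), (∀ k, |U k - z^k.1| ≤ ε) →
      |∑ k, b k * U k - ∑ k, b k * z ^ k.1| ≤ A * (ε * D^N) := by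
    intro U ε hU
    rw [← Finset.sum_sub_distrib, hA, Finset.sum_mul]
    refine (Finset.abs_sum_le_sum_abs _ _).trans (Finset.sum_le_sum fun k _ => ?_)
    rw [← mul_sub, abs_mul]
    calc |b k| * |U k - z^k.1| ≤ (|a k| * D^N) * ε :=
          mul_le_mul (hbb k) (hU k) (abs_nonneg _) (by positivity)
      _ = _ := by ring
  have hzk : ∀ k : ℕ, |z^k| ≤ 1 := fun k => by
    rw [abs_pow]; exact pow_le_one₀ (abs_nonneg _) hz
  rcases Nat.lt_or_ge (i/L) 2 with hq | hq
  · have ht2 : t ≤ 4 * L * 2 := by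
      refine ht.trans (Nat.mul_le_mul_left _ ?_)
      generalize i / L = q at hq
      interval_cases q <;> simp
    have hr := rate hL ht2
    have h2 : |(if i = 0 then 0 else ∑ k, b k * V k (last L (i-1))) - ∑ k, b k * z^k.1| ≤ A * (2 * D^N) := by
      split_ifs with hi
      · have := est (fun _ => 0) 2 (fun k => by
          rw [zero_sub, abs_neg]; exact (hzk _).trans one_le_two)
        simpa using this
      · refine est _ 2 (fun k => ?_)
        refine (abs_sub _ _).trans ?_
        linarith [hVb (last L (i-1)) k, hzk k.1]
    refine h2.trans ?_
    calc A * (2 * D^N) ≤ A * ((16 * N * D^(2*N)) * (1/4)^2) := by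
          refine mul_le_mul_of_nonneg_left ?_ hA0
          have := mul_le_mul hN' hDN hDN0.le (by linarith)
          linarith
      _ = A * (16 * N * D^(2*N)) * (1/4)^2 := by ring
      _ ≤ _ := by gcongr
  · have hr := rate hL ht
    have hiL : 2 * L ≤ i := by
      have := (Nat.le_div_iff_mul_le hL).mp hq
      exact this
    rw [if_neg (by omega)]
    have hlen : len L (i - 1 + 1 - L) = 2^(i/L) := by
      have e : i - 1 + 1 - L = i - L := by omega
      rw [e, len]
      congr 1
      have : i = (i - L) + L := by omega
      conv_rhs => rw [this, Nat.add_div_right _ hL]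
    have h2 := est (fun k => V k (last L (i-1))) (N * (1/4)^(2^(i/L))) (fun k => by
      rcases Nat.eq_zero_or_pos k.1 with hk | hk
      · rw [hV0 _ k hk, hk]; simp
      · have hkN : k.1 ≤ N := by have := k.2; omega
        have := hVp L (i-1) k (by omega) hk (hkN.trans hNL)
        rw [hlen] at this
        refine this.trans ?_
        have : (k.1:ℝ) ≤ N := by exact_mod_cast hkN
        gcongr
        linarith)
    refine h2.trans ?_
    calc A * ((N * (1/4)^(2^(i/L))) * D^N) ≤ A * ((N * (1/4)^(2^(i/L))) * (16 * D^(2*N))) := by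
          gcongr
          linarith
      _ = A * (16 * N * D^(2*N)) * (1/4)^(2^(i/L)) := by ring
      _ ≤ _ := by gcongr

/-- Main theorem (RNN approximation of polynomials): for `N ∈ ℕ`, `D ≥ 1`, and
coefficients `a_0, …, a_N ∈ ℝ`, there is an RNN with input dimension 1, output
dimension 1, and hidden state size at most `80N + 11` such that for all `x ∈ [−D, D]`
and all `t ≥ 16·log₂ N`:
`|(R 𝒟 x)[t] − ∑_{i=0}^N a_i x^i| ≤ ‖a‖₁ · C₁ · 4^{−C₂ t}`, with `C₁ = 16·N·D^{2N}`
and `C₂ = 1/(4⌈log₂ N⌉)` (where `⌈log₂⌉ = Nat.clog 2`). -/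
theorem stmt19 (N : ℕ) (hN : 1 ≤ N) (D : ℝ) (hD : 1 ≤ D) (a : Fin (N + 1) → ℝ) :
    ∃ (mh : ℕ) (R : RNN (Fin 1) (Fin mh) (Fin 1)),
      mh ≤ 80 * N + 11 ∧
      ∀ x : ℝ, x ∈ Set.Icc (-D) D → ∀ t : ℕ, 16 * Real.logb 2 N ≤ (t : ℝ) →
        |R.out (fun _ => x) t 0 - ∑ i : Fin (N + 1), a i * x ^ (i : ℕ)| ≤
          (∑ i : Fin (N + 1), |a i|) * (16 * N * D ^ (2 * N)) *
            (4 : ℝ) ^ (-(1 / (4 * (Nat.clog 2 N : ℝ))) * (t : ℝ)) := by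
  rcases Nat.lt_or_ge N 2 with h | h
  · obtain rfl : N = 1 := by omega
    refine ⟨0, ⟨0, 0, 0, 0, 0⟩, by omega, fun x hx t _ => ?_⟩
    have hx' : |x| ≤ D := abs_le.mpr hx
    simp only [RNN.out, Matrix.zero_mulVec, Pi.add_apply, Pi.zero_apply]
    simp
    have h1 : |a 0 + a 1 * x| ≤ |a 0| + |a 1| * |x| := by
      refine (abs_add_le _ _).trans ?_
      rw [abs_mul]
    have h2 := abs_nonneg (a 0)
    have h3 := abs_nonneg (a 1)
    have h4 : |a 1| * |x| ≤ |a 1| * D := mul_le_mul_of_nonneg_left hx' h3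
    have h5 : D ≤ 16 * D^2 := by nlinarith
    have h6 : 1 ≤ 16 * D^2 := by nlinarith
    rw [show -(a 1 * x) + -a 0 = -(a 0 + a 1 * x) by ring, abs_neg]
    nlinarith
  · obtain ⟨mh, R, h1, h2⟩ := main_case (Nat.clog 2 N) N (Nat.clog_pos (by norm_num) h) h
      (Nat.le_pow_clog (by norm_num) N) D hD a
    exact ⟨mh, R, h1, fun x hx t _ => h2 x hx t⟩
end
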